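/- arXiv:2601.00179 — 2 statements merged into one kernel-verified Lean document; each statement's English description precedes it below -/
import Mathlib

section
/- For every sequence (a_i)_{i∈ℕ} of real numbers there exists a regular Toeplitz subshift X ⊆ Bool^ℤ that is uniquely ergodic, i.e. the shift σ restricted to X has exactly one invariant Borel probability measure μ, and such that the set {∫_X f dμ : f ∈ C(X,ℤ)} is exactly the ℚ-linear span of {1} ∪ {a_i : i ∈ ℕ} inside ℝ. -/
open MeasureTheory TopologicalSpace Topology

abbrev Cantor : Type := ℤ → Bool

def zOrbit {X : Type*} (φ : X → X) (x : X) : Set X :=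
  {y | ∃ n : ℕ, φ^[n] x = y ∨ φ^[n] y = x}

def shift {A : Type*} : (ℤ → A) → (ℤ → A) := fun x n => x (n + 1)

def IsToeplitz {A : Type*} (x : ℤ → A) : Prop :=
  ∀ k : ℤ, ∃ p : ℕ, 1 ≤ p ∧ ∀ n : ℤ, x (k + n * p) = x k

noncomputable def toeplitzDelta {A : Type*} (x : ℤ → A) (p : ℕ) : ℝ :=
  ({k : ℤ | 0 ≤ k ∧ k < (p : ℤ) ∧ ∀ n : ℤ, x (k + n * p) = x k}.ncard : ℝ) / p

def IsRegularToeplitz {A : Type*} (x : ℤ → A) : Prop :=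
  IsToeplitz x ∧ sSup {d : ℝ | ∃ p : ℕ, 1 ≤ p ∧ d = toeplitzDelta x p} = 1

def IsRegularToeplitzSubshift {A : Type*} [TopologicalSpace A] (X : Set (ℤ → A)) : Prop :=
  ∃ x : ℤ → A, IsRegularToeplitz x ∧ X = closure (zOrbit shift x)

/-- A probability measure on `A^ℤ` is an invariant probability measure for the subsystem
`(X, σ|X)` iff it is shift-invariant and gives `X` full measure. -/
def IsInvariantOn {A : Type*} [MeasurableSpace A] (X : Set (ℤ → A))
    (μ : ProbabilityMeasure (ℤ → A)) : Prop :=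
  (∀ B : Set (ℤ → A), MeasurableSet B → μ.toMeasure (shift ⁻¹' B) = μ.toMeasure B) ∧
    μ.toMeasure X = 1

/-- A value of a density function that is neither `0` nor `1`: the position is not yet filled. -/
def IsHole (β : ℤ → ℝ) (n : ℤ) : Prop := β n ≠ 0 ∧ β n ≠ 1

/-- A periodic partial filling: `β n` is the density with which the symbol `1` will eventually
occur at positions congruent to `n` modulo `p`. -/
structure Stage (V : Submodule ℚ ℝ) where
  p : ℕ
  β : ℤ → ℝ
  pos : 0 < p
  per : ∀ n, β (n + p) = β n
  mem : ∀ n, β n ∈ V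
  nonneg : ∀ n, 0 ≤ β n
  le_one : ∀ n, β n ≤ 1
  exists_hole : ∃ n, IsHole β n

/-- `s'` refines `s`, adding the value `v` to the group generated by the densities. -/
structure Refines {V : Submodule ℚ ℝ} (v : ℝ) (d : ℕ) (s s' : Stage V) (q : ℕ) : Prop where
  p_eq : s'.p = q * s.p
  dvd : d ∣ q
  two_le : 2 ≤ q
  zero : ∀ n, s.β n = 0 → s'.β n = 0
  one : ∀ n, s.β n = 1 → s'.β n = 1
  sum : ∀ n, ∑ j ∈ Finset.range q, s'.β (n + j * s.p) = q * s.β n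
  filled : ∀ n : ℤ, |n| < s.p → ¬ IsHole s'.β n
  gap : ∀ n n' : ℤ, IsHole s'.β n → IsHole s'.β n' → n ≠ n' → (s.p : ℤ) ≤ |n - n'|
  value : ∃ n, ∃ t : ℚ, s'.β n = v + t
  recog : ∃ r a : ℤ, s'.β (r + a * s.p) = 0 ∧ s'.β (r + (a + 1) * s.p) = 1 ∧
    s'.β (r + (a + 2) * s.p) = 1 ∧ ∀ b : ℤ, s'.β (r + b * s.p) ≠ 1 →
      s'.β (r + (b + 1) * s.p) ≠ 0 → s'.β (r + (b + 2) * s.p) ≠ 0 → (q : ℤ) ∣ b - a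

lemma periodic_add_mul {α : Type*} {f : ℤ → α} {p : ℤ} (h : ∀ n, f (n + p) = f n) (n k : ℤ) :
    f (n + k * p) = f n := by
  have : Function.Periodic f p := h
  simpa using this.int_mul k n

lemma periodic_emod {α : Type*} {f : ℤ → α} {p : ℤ} (h : ∀ n, f (n + p) = f n) (n : ℤ) :
    f (n % p) = f n := by
  conv_rhs => rw [← Int.emod_add_mul_ediv n p, mul_comm, periodic_add_mul h]

lemma sum_range_add_of_periodic {f : ℤ → ℝ} {q : ℕ} (h : ∀ n, f (n + q) = f n) (a : ℤ) :
    ∑ j ∈ Finset.range q, f (a + j) = ∑ j ∈ Finset.range q, f j := by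
  have step : ∀ a : ℤ, ∑ j ∈ Finset.range q, f (a + 1 + j) = ∑ j ∈ Finset.range q, f (a + j) := by
    intro a
    have h1 := Finset.sum_range_succ (fun j : ℕ => f (a + j)) q
    have h2 := Finset.sum_range_succ' (fun j : ℕ => f (a + j)) q
    have h3 : ∀ j : ℕ, f (a + 1 + j) = f (a + (j + 1 : ℕ)) := by
      intro j; congr 1; push_cast; ring
    simp only [h3]
    have h4 := h a
    simp only [Nat.cast_zero, add_zero] at h2
    linarith
  induction a using Int.induction_on with
  | zero => simp
  | succ i ih => rw [step, ih]
  | pred i ih => rw [← ih, ← step]; simp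

lemma sum_range_mul_eq (f : ℤ → ℝ) (q p : ℕ) :
    ∑ i ∈ Finset.range (q * p), f i
      = ∑ i ∈ Finset.range p, ∑ j ∈ Finset.range q, f (i + j * p) := by
  rw [Finset.sum_comm]
  induction q with
  | zero => simp
  | succ q ih =>
    rw [Nat.succ_mul, Finset.sum_range_add, ih, Finset.sum_range_succ]
    congr 1
    refine Finset.sum_congr rfl fun i _ => ?_
    congr 1; push_cast; ring

/-- The filling of a single hole, of density `(c + g + g') / q`, over one period of length `q`. -/
noncomputable def holePattern (q c r : ℤ) (g g' : ℝ) (i : ℤ) : ℝ :=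
  if i = 4 * r + 1 then g else if i = 4 * r + 3 then g' else if q - c ≤ i then 1 else 0

lemma sum_holePattern {q : ℕ} {c r : ℤ} (g g' : ℝ) (hr : 0 ≤ r) (hc : 0 ≤ c)
    (h : 4 * r + 3 < q - c) :
    ∑ i ∈ Finset.range q, holePattern q c r g g' i = c + g + g' := by
  lift r to ℕ using hr
  lift c to ℕ using hc
  have : ∀ i ∈ Finset.range q, holePattern q c r g g' i
      = (if i = 4 * r + 1 then g else 0) + (if i = 4 * r + 3 then g' else 0)
        + (if i ∈ Finset.Ico (q - c) q then 1 else 0) := by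
    intro i hi
    simp only [Finset.mem_range] at hi
    have e1 : ((i : ℤ) = 4 * r + 1) ↔ i = 4 * r + 1 := by omega
    have e2 : ((i : ℤ) = 4 * r + 3) ↔ i = 4 * r + 3 := by omega
    have e3 : ((q : ℤ) - c ≤ i) ↔ i ∈ Finset.Ico (q - c) q := by
      simp only [Finset.mem_Ico]; omega
    simp only [holePattern, e1, e2, e3]
    by_cases h1 : i = 4 * r + 1
    · have : i ∉ Finset.Ico (q - c) q := by simp only [Finset.mem_Ico]; omega
      simp [h1]
      omega
    · by_cases h2 : i = 4 * r + 3
      · have : i ∉ Finset.Ico (q - c) q := by simp only [Finset.mem_Ico]; omega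
        simp [h2]
        omega
      · simp [h1, h2]
  rw [Finset.sum_congr rfl this, Finset.sum_add_distrib, Finset.sum_add_distrib]
  rw [Finset.sum_ite_eq', Finset.sum_ite_eq', Finset.sum_ite_mem]
  have hI : Finset.range q ∩ Finset.Ico (q - c) q = Finset.Ico (q - c) q := by
    ext i; simp only [Finset.mem_inter, Finset.mem_range, Finset.mem_Ico]; omega
  rw [hI, if_pos (by simp only [Finset.mem_range]; omega),
    if_pos (by simp only [Finset.mem_range]; omega)]
  simp only [Finset.sum_const, Nat.card_Ico, nsmul_eq_mul, mul_one]
  rw [show q - (q - c) = c by omega]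
  push_cast
  ring

lemma holePattern_left {q c r : ℤ} {g g' : ℝ} : holePattern q c r g g' (4 * r + 1) = g := by
  simp [holePattern]

lemma holePattern_mem {q c r : ℤ} {g g' : ℝ} {i : ℤ} {S : Set ℝ} (h0 : 0 ∈ S) (h1 : 1 ∈ S)
    (hg : g ∈ S) (hg' : g' ∈ S) : holePattern q c r g g' i ∈ S := by
  unfold holePattern; split_ifs <;> assumption

lemma holePattern_isHole {q c r : ℤ} {g g' : ℝ} {i : ℤ}
    (h0 : holePattern q c r g g' i ≠ 0) (h1 : holePattern q c r g g' i ≠ 1) :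
    i = 4 * r + 1 ∨ i = 4 * r + 3 := by
  unfold holePattern at h0 h1; split_ifs at h0 h1 <;> simp_all

lemma holePattern_eq_zero {q c r : ℤ} {g g' : ℝ} {i : ℤ} (h1 : i ≠ 4 * r + 1)
    (h2 : i ≠ 4 * r + 3) (h3 : i < q - c) : holePattern q c r g g' i = 0 := by
  simp [holePattern, h1, h2, not_le.2 h3]

lemma holePattern_eq_one {q c r : ℤ} {g g' : ℝ} {i : ℤ} (h3 : 4 * r + 3 < i)
    (h4 : q - c ≤ i) : holePattern q c r g g' i = 1 := by
  have h1 : i ≠ 4 * r + 1 := by omega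
  have h2 : i ≠ 4 * r + 3 := by omega
  simp [holePattern, h1, h2, h4]

lemma exists_split {V : Submodule ℚ ℝ} (hV : (1 : ℝ) ∈ V) {v : ℝ} (hv : v ∈ V) {x : ℝ}
    (hx : x ∈ V) (q : ℕ) :
    ∃ c : ℤ, ∃ g g' : ℝ, g ∈ V ∧ g' ∈ V ∧ 0 < g ∧ g < 1 ∧ 0 < g' ∧ g' < 1 ∧
      (∃ t : ℚ, g = v + t) ∧ c + g + g' = q * x ∧ q * x - 1 ≤ c ∧ c ≤ q * x := by
  have hrat : ∀ t : ℚ, (t : ℝ) ∈ V := fun t => by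
    simpa [Algebra.smul_def] using V.smul_mem t hV
  set c : ℤ := ⌈(q : ℝ) * x⌉ - 1 with hc
  have h1 := Int.le_ceil ((q : ℝ) * x)
  have h2 := Int.ceil_lt_add_one ((q : ℝ) * x)
  have hc' : (c : ℝ) = ⌈(q : ℝ) * x⌉ - 1 := by rw [hc]; push_cast; ring
  obtain ⟨t, ht, ht'⟩ := exists_rat_btwn (show -v < (q * x - c) - v by linarith)
  have hqx : (q : ℝ) * x ∈ V := by
    simpa [Algebra.smul_def] using V.smul_mem (q : ℚ) hx
  refine ⟨c, v + t, q * x - c - (v + t), V.add_mem hv (hrat t), ?_, by linarith, by linarith,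
    by linarith, by linarith, ⟨t, rfl⟩, by ring, by linarith, by linarith⟩
  refine V.sub_mem (V.sub_mem hqx ?_) (V.add_mem hv (hrat t))
  simpa using hrat c

lemma Stage.pos_of_isHole {V : Submodule ℚ ℝ} (s : Stage V) {n : ℤ} (h : IsHole s.β n) :
    0 < s.β n := lt_of_le_of_ne (s.nonneg n) (Ne.symm h.1)

lemma Stage.lt_one_of_isHole {V : Submodule ℚ ℝ} (s : Stage V) {n : ℤ} (h : IsHole s.β n) :
    s.β n < 1 := lt_of_le_of_ne (s.le_one n) h.2

lemma Stage.exists_multiplier {V : Submodule ℚ ℝ} (s : Stage V) {d : ℕ} (hd : 0 < d) :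
    ∃ q : ℕ, d ∣ q ∧ 2 ∣ q ∧ 4 * s.p + 2 ≤ q ∧ ∀ n, IsHole s.β n →
      3 ≤ q * s.β n ∧ q * s.β n ≤ q - (4 * s.p + 4) := by
  have key : ∀ᶠ t : ℕ in Filter.atTop, ∀ n ∈ Finset.range s.p, IsHole s.β n →
      3 ≤ t * s.β n ∧ t * s.β n ≤ t - (4 * s.p + 4) := by
    rw [Filter.eventually_all_finset]
    intro n _
    by_cases h : IsHole s.β n
    · have hp := s.pos_of_isHole h
      have hl := s.lt_one_of_isHole h
      have h1 : Filter.Tendsto (fun t : ℕ => (t : ℝ) * s.β n) Filter.atTop Filter.atTop :=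
        tendsto_natCast_atTop_atTop.atTop_mul_const hp
      have h2 : Filter.Tendsto (fun t : ℕ => (t : ℝ) * (1 - s.β n)) Filter.atTop Filter.atTop :=
        tendsto_natCast_atTop_atTop.atTop_mul_const (by linarith)
      filter_upwards [h1.eventually_ge_atTop 3, h2.eventually_ge_atTop (4 * s.p + 4)] with t h3 h4
      exact fun _ => ⟨h3, by linarith⟩
    · exact Filter.Eventually.of_forall fun t h' => absurd h' h
  obtain ⟨T, hT⟩ := Filter.eventually_atTop.1 key
  have hle : T + (4 * s.p + 2) ≤ 2 * d * (T + (4 * s.p + 2)) :=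
    Nat.le_mul_of_pos_left _ (by omega)
  refine ⟨2 * d * (T + (4 * s.p + 2)), ⟨2 * (T + (4 * s.p + 2)), by ring⟩,
    ⟨d * (T + (4 * s.p + 2)), by ring⟩, by omega, fun n hn => ?_⟩
  have hp : (0 : ℤ) < s.p := by exact_mod_cast s.pos
  have hmod := periodic_emod s.per n
  have h0 := Int.emod_nonneg n hp.ne'
  have h1 := Int.emod_lt_of_pos n hp
  lift n % (s.p : ℤ) to ℕ using h0 with m hm
  have := hT _ (le_trans (Nat.le_add_right _ _) hle) m (by simpa using h1)
    (by rw [IsHole, hmod]; exact hn)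
  rwa [hmod] at this

lemma exists_refines {V : Submodule ℚ ℝ} (hV : (1 : ℝ) ∈ V) {v : ℝ} (hv : v ∈ V) {d : ℕ}
    (hd : 0 < d) (s : Stage V) : ∃ s' : Stage V, ∃ q : ℕ, Refines v d s s' q := by
  classical
  obtain ⟨q, hdq, h2q, hq, hhole⟩ := s.exists_multiplier hd
  choose c g g' hgV hg'V hg0 hg1 hg'0 hg'1 hgv hsum hc1 hc2 using
    fun n => exists_split hV hv (s.mem n) q
  have hp : (0 : ℤ) < s.p := by exact_mod_cast s.pos
  have hq0 : (0 : ℤ) < q := by omega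
  have hr0 : ∀ n : ℤ, 0 ≤ n % (s.p : ℤ) := fun n => Int.emod_nonneg n hp.ne'
  have hr1 : ∀ n : ℤ, n % (s.p : ℤ) < s.p := fun n => Int.emod_lt_of_pos n hp
  have hmod : ∀ n : ℤ, s.β (n % s.p) = s.β n := periodic_emod s.per
  have hole_mod : ∀ n : ℤ, IsHole s.β n → IsHole s.β (n % s.p) := fun n h => by
    rwa [IsHole, hmod]
  have hcb : ∀ n, IsHole s.β n → 2 ≤ c n ∧ 4 * (s.p : ℤ) + 4 ≤ q - c n := by
    intro n hn
    obtain ⟨h3, h4⟩ := hhole n hn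
    have h5 := hc1 n
    have h6 := hc2 n
    constructor
    · have : (2 : ℝ) ≤ c n := by linarith
      exact_mod_cast this
    · have : 4 * (s.p : ℝ) + 4 ≤ q - c n := by linarith
      exact_mod_cast this
  let β' : ℤ → ℝ := fun n => if IsHole s.β n then
    holePattern q (c (n % s.p)) (n % s.p) (g (n % s.p)) (g' (n % s.p)) ((n / s.p) % q) else s.β n
  have hβ'hole : ∀ n, IsHole s.β n → β' n = holePattern q (c (n % s.p)) (n % s.p) (g (n % s.p))
      (g' (n % s.p)) ((n / s.p) % q) := fun n h => if_pos h
  have hβ'not : ∀ n, ¬ IsHole s.β n → β' n = s.β n := fun n h => if_neg h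
  have hβ'per : ∀ n, β' (n + (q * s.p : ℕ)) = β' n := by
    intro n
    have e1 : IsHole s.β (n + (q * s.p : ℕ)) ↔ IsHole s.β n := by
      unfold IsHole; push_cast; rw [periodic_add_mul s.per]
    have e2 : (n + (q * s.p : ℕ)) % (s.p : ℤ) = n % s.p := by
      push_cast; exact Int.add_mul_emod_self_right _ _ _
    have e3 : ((n + (q * s.p : ℕ)) / (s.p : ℤ)) % q = (n / s.p) % q := by
      push_cast; rw [Int.add_mul_ediv_right _ _ hp.ne', Int.add_emod_right]
    have e4 : s.β (n + (q * s.p : ℕ)) = s.β n := by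
      push_cast; rw [periodic_add_mul s.per]
    simp only [β', e1, e2, e3, e4]
  have hole' : ∀ n, IsHole β' n → IsHole s.β n ∧
      ((n / s.p) % q = 4 * (n % s.p) + 1 ∨ (n / s.p) % q = 4 * (n % s.p) + 3) := by
    intro n hn
    by_cases h : IsHole s.β n
    · refine ⟨h, ?_⟩
      rw [IsHole, hβ'hole n h] at hn
      exact holePattern_isHole hn.1 hn.2
    · rw [IsHole, hβ'not n h] at hn
      exact absurd hn h
  -- the values along the residue class of a hole
  have along : ∀ n, IsHole s.β n → ∀ b : ℤ, β' (n % s.p + b * s.p) = holePattern q (c (n % s.p))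
      (n % s.p) (g (n % s.p)) (g' (n % s.p)) (b % q) := by
    intro n hn b
    have e1 : (n % (s.p : ℤ) + b * s.p) % s.p = n % s.p := by simp
    have e2 : (n % (s.p : ℤ) + b * s.p) / s.p = b := by
      rw [Int.add_mul_ediv_right _ _ hp.ne', Int.ediv_eq_zero_of_lt (hr0 n) (hr1 n), zero_add]
    rw [hβ'hole _ (by rw [IsHole, periodic_add_mul s.per]; exact hole_mod n hn), e1, e2]
  obtain ⟨n₀, hn₀⟩ := s.exists_hole
  have hval : β' (n₀ % s.p + (4 * (n₀ % s.p) + 1) * s.p) = g (n₀ % s.p) := by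
    have := hr0 n₀
    have := hr1 n₀
    rw [along n₀ hn₀, Int.emod_eq_of_lt (a := 4 * (n₀ % s.p) + 1) (by omega) (by omega),
      holePattern_left]
  let s' : Stage V :=
    { p := q * s.p
      β := β'
      pos := Nat.mul_pos (by omega) s.pos
      per := hβ'per
      mem := by
        intro n
        by_cases h : IsHole s.β n
        · rw [hβ'hole n h]
          exact holePattern_mem (S := V) V.zero_mem hV (hgV _) (hg'V _)
        · rw [hβ'not n h]; exact s.mem n
      nonneg := by
        intro n
        by_cases h : IsHole s.β n
        · rw [hβ'hole n h]
          exact holePattern_mem (S := Set.Ici 0) (by simp) (by simp) (hg0 _).le (hg'0 _).le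
        · rw [hβ'not n h]; exact s.nonneg n
      le_one := by
        intro n
        by_cases h : IsHole s.β n
        · rw [hβ'hole n h]
          exact holePattern_mem (S := Set.Iic 1) (by simp) (by simp) (hg1 _).le (hg'1 _).le
        · rw [hβ'not n h]; exact s.le_one n
      exists_hole := ⟨_, by rw [IsHole, hval]; exact ⟨(hg0 _).ne', (hg1 _).ne⟩⟩ }
  refine ⟨s', q, rfl, hdq, by omega, ?_, ?_, ?_, ?_, ?_, ?_, ?_⟩
  · intro n hn
    rw [show s'.β n = β' n from rfl, hβ'not n (fun h => h.1 hn), hn]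
  · intro n hn
    rw [show s'.β n = β' n from rfl, hβ'not n (fun h => h.2 hn), hn]
  · intro n
    change ∑ j ∈ Finset.range q, β' (n + j * s.p) = q * s.β n
    by_cases h : IsHole s.β n
    · have e : ∀ j : ℕ, β' (n + j * s.p) = holePattern q (c (n % s.p)) (n % s.p) (g (n % s.p))
          (g' (n % s.p)) ((n / s.p + j) % q) := by
        intro j
        rw [← along n h]
        congr 1
        have := Int.emod_add_mul_ediv n s.p
        linear_combination -this
      simp only [e]
      rw [sum_range_add_of_periodic (f := fun i => holePattern q (c (n % s.p)) (n % s.p)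
        (g (n % s.p)) (g' (n % s.p)) (i % q)) (fun i => by simp)]
      have e' : ∀ j ∈ Finset.range q, holePattern q (c (n % s.p)) (n % s.p) (g (n % s.p))
          (g' (n % s.p)) ((j : ℤ) % q) = holePattern q (c (n % s.p)) (n % s.p) (g (n % s.p))
          (g' (n % s.p)) j := by
        intro j hj
        rw [Int.emod_eq_of_lt (a := (j : ℤ)) (by omega) (by exact_mod_cast Finset.mem_range.1 hj)]
      have := hcb _ (hole_mod n h)
      have := hr1 n
      rw [Finset.sum_congr rfl e', sum_holePattern _ _ (hr0 n) (by omega) (by omega), hsum, hmod]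
    · have e : ∀ j : ℕ, β' (n + j * s.p) = s.β n := by
        intro j
        rw [hβ'not _ (by rwa [IsHole, periodic_add_mul s.per]), periodic_add_mul s.per]
      simp [e]
  · intro n hn hh
    obtain ⟨-, h⟩ := hole' n hh
    have := hr0 n
    have := hr1 n
    rw [abs_lt] at hn
    rcases lt_or_ge n 0 with h0 | h0
    · have e : n / (s.p : ℤ) = -1 := by
        rw [Int.ediv_eq_iff_of_pos hp]; constructor <;> linarith
      rw [e, show (-1 : ℤ) = (q - 1) + q * (-1) by ring, Int.add_mul_emod_self_left,
        Int.emod_eq_of_lt (by omega) (by omega)] at h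
      omega
    · rw [Int.ediv_eq_zero_of_lt h0 hn.2] at h
      simp at h
      omega
  · intro n n' hn hn' hne
    obtain ⟨-, h⟩ := hole' n hn
    obtain ⟨-, h'⟩ := hole' n' hn'
    have d1 := Int.emod_add_mul_ediv n s.p
    have d2 := Int.emod_add_mul_ediv n' s.p
    have := hr0 n
    have := hr1 n
    have := hr0 n'
    have := hr1 n'
    have h2q' : (2 : ℤ) ∣ q := by exact_mod_cast h2q
    have m1 := Int.emod_emod_of_dvd (n / s.p) h2q'
    have m2 := Int.emod_emod_of_dvd (n' / s.p) h2q'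
    generalize n / (s.p : ℤ) = a at *
    generalize n' / (s.p : ℤ) = a' at *
    generalize n % (s.p : ℤ) = r at *
    generalize n' % (s.p : ℤ) = r' at *
    have hne' : a ≠ a' := by
      rintro rfl
      apply hne
      have : r = r' := by omega
      rw [← d1, ← d2, this]
    have h3 : a + 2 ≤ a' ∨ a' + 2 ≤ a := by omega
    rw [le_abs]
    rcases h3 with h3 | h3
    · right; nlinarith
    · left; nlinarith
  · obtain ⟨t, ht⟩ := hgv (n₀ % s.p)
    exact ⟨_, t, by rw [← ht]; exact hval⟩
  · have hc := hcb _ (hole_mod n₀ hn₀)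
    have := hr0 n₀
    have := hr1 n₀
    refine ⟨n₀ % s.p, q - c (n₀ % s.p) - 1, ?_, ?_, ?_, ?_⟩
    · change β' _ = _
      rw [along n₀ hn₀, Int.emod_eq_of_lt (a := q - c (n₀ % s.p) - 1) (by omega) (by omega)]
      exact holePattern_eq_zero (by omega) (by omega) (by omega)
    · change β' _ = _
      rw [along n₀ hn₀,
        Int.emod_eq_of_lt (a := q - c (n₀ % s.p) - 1 + 1) (by omega) (by omega)]
      exact holePattern_eq_one (by omega) (by omega)
    · change β' _ = _
      rw [along n₀ hn₀,
        Int.emod_eq_of_lt (a := q - c (n₀ % s.p) - 1 + 2) (by omega) (by omega)]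
      exact holePattern_eq_one (by omega) (by omega)
    · intro b
      change β' _ ≠ _ → β' _ ≠ _ → β' _ ≠ _ → _
      rw [along n₀ hn₀, along n₀ hn₀, along n₀ hn₀]
      intro h0 h1 h2
      have hb0 := Int.emod_nonneg b hq0.ne'
      have hb1 := Int.emod_lt_of_pos b hq0
      have hbig : b % (q : ℤ) < q - c (n₀ % s.p) := by
        by_contra hcon
        exact h0 (holePattern_eq_one (by omega) (by omega))
      have e1 : (b + 1) % (q : ℤ) = b % q + 1 := by
        rw [Int.add_emod_eq_add_emod_right 1 (Int.emod_emod_of_dvd b dvd_rfl).symm]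
        exact Int.emod_eq_of_lt (by omega) (by omega)
      have e2 : (b + 2) % (q : ℤ) = b % q + 2 := by
        rw [Int.add_emod_eq_add_emod_right 2 (Int.emod_emod_of_dvd b dvd_rfl).symm]
        exact Int.emod_eq_of_lt (by omega) (by omega)
      rw [e1] at h1
      rw [e2] at h2
      have key : b % (q : ℤ) = q - c (n₀ % s.p) - 1 := by
        by_contra hcon
        by_cases h3 : b % (q : ℤ) + 1 = 4 * (n₀ % s.p) + 1 ∨
            b % (q : ℤ) + 1 = 4 * (n₀ % s.p) + 3
        · exact h2 (holePattern_eq_zero (by omega) (by omega) (by omega))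
        · exact h1 (holePattern_eq_zero (by omega) (by omega) (by omega))
      refine Int.dvd_of_emod_eq_zero ?_
      rw [← key]
      simp

/-- A sequence of stages, each refining the previous one. -/
structure Tower (V : Submodule ℚ ℝ) where
  stage : ℕ → Stage V
  q : ℕ → ℕ
  v : ℕ → ℝ
  p_zero : (stage 0).p = 1
  refines : ∀ k, Refines (v k) (k + 1) (stage k) (stage (k + 1)) (q k)
  surj : ∀ w ∈ V, ∃ k, v k = w

lemma Submodule.countable_span_rat (a : ℕ → ℝ) :
    (Submodule.span ℚ ({1} ∪ Set.range a) : Set ℝ).Countable := by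
  have h : ({1} ∪ Set.range a : Set ℝ).Countable :=
    (Set.countable_singleton 1).union (Set.countable_range a)
  have := h.to_subtype
  have h2 : Countable (Submodule.span ℚ (Set.range ((↑) : ({1} ∪ Set.range a : Set ℝ) → ℝ))) :=
    inferInstance
  rw [Subtype.range_coe] at h2
  exact Set.countable_coe_iff.1 h2

lemma exists_tower {V : Submodule ℚ ℝ} (hV : (1 : ℝ) ∈ V) (hc : (V : Set ℝ).Countable) :
    Nonempty (Tower V) := by
  obtain ⟨v, hv⟩ := hc.exists_eq_range ⟨0, V.zero_mem⟩
  have hvm : ∀ k, v k ∈ V := fun k => by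
    have : v k ∈ (V : Set ℝ) := hv ▸ Set.mem_range_self k
    exact this
  have half : (2⁻¹ : ℝ) ∈ V := by
    have := V.smul_mem (2⁻¹ : ℚ) hV
    simpa [Algebra.smul_def] using this
  let s₀ : Stage V :=
    { p := 1
      β := fun _ => 2⁻¹
      pos := one_pos
      per := fun _ => rfl
      mem := fun _ => half
      nonneg := fun _ => by norm_num
      le_one := fun _ => by norm_num
      exists_hole := ⟨0, by norm_num [IsHole]⟩ }
  choose next q hnext using fun (k : ℕ) (s : Stage V) =>
    exists_refines hV (hvm k) (Nat.succ_pos k) s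
  let S : ℕ → Stage V := fun k => Nat.rec s₀ next k
  refine ⟨⟨S, fun k => q k (S k), v, rfl, fun k => hnext k (S k), fun w hw => ?_⟩⟩
  have : w ∈ Set.range v := hv ▸ hw
  exact this

namespace Tower

variable {V : Submodule ℚ ℝ} (T : Tower V)

/-- The period of the `k`-th stage. -/
def p (k : ℕ) : ℕ := (T.stage k).p

/-- The density function of the `k`-th stage. -/
def β (k : ℕ) : ℤ → ℝ := (T.stage k).β

lemma p_pos (k : ℕ) : 0 < T.p k := (T.stage k).pos

lemma p_succ (k : ℕ) : T.p (k + 1) = T.q k * T.p k := (T.refines k).p_eq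

lemma per (k : ℕ) (n : ℤ) : T.β k (n + T.p k) = T.β k n := (T.stage k).per n

lemma two_pow_le (k : ℕ) : 2 ^ k ≤ T.p k := by
  induction k with
  | zero => exact T.p_pos 0
  | succ k ih =>
    rw [p_succ, pow_succ, mul_comm]
    exact Nat.mul_le_mul (T.refines k).two_le ih

lemma lt_p (k : ℕ) : k < T.p k := lt_of_lt_of_le Nat.lt_two_pow_self (T.two_pow_le k)

lemma p_dvd {k l : ℕ} (h : k ≤ l) : T.p k ∣ T.p l := by
  induction h with
  | refl => rfl
  | step _ ih => exact ih.trans ⟨T.q _, by rw [p_succ, mul_comm]⟩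

lemma p_mono {k l : ℕ} (h : k ≤ l) : T.p k ≤ T.p l :=
  Nat.le_of_dvd (T.p_pos l) (T.p_dvd h)

lemma dvd_p {d : ℕ} (hd : 0 < d) : d ∣ T.p d := by
  obtain ⟨k, rfl⟩ : ∃ k, d = k + 1 := ⟨d - 1, by omega⟩
  rw [p_succ]
  exact (T.refines k).dvd.mul_right _

lemma eq_zero_mono {k l : ℕ} (h : k ≤ l) {n : ℤ} (hn : T.β k n = 0) : T.β l n = 0 := by
  induction h with
  | refl => exact hn
  | step _ ih => exact (T.refines _).zero n ih

lemma eq_one_mono {k l : ℕ} (h : k ≤ l) {n : ℤ} (hn : T.β k n = 1) : T.β l n = 1 := by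
  induction h with
  | refl => exact hn
  | step _ ih => exact (T.refines _).one n ih

open Classical in
/-- The Toeplitz sequence that is the limit of the stages. -/
noncomputable def x : Cantor := fun n => decide (∃ k, T.β k n = 1)

lemma x_of_eq_one {k : ℕ} {n : ℤ} (h : T.β k n = 1) : T.x n = true := by
  simp only [x, decide_eq_true_eq]
  exact ⟨k, h⟩

lemma x_of_eq_zero {k : ℕ} {n : ℤ} (h : T.β k n = 0) : T.x n = false := by
  simp only [x, decide_eq_false_iff_not, not_exists]
  intro l hl
  have h0 := T.eq_zero_mono (le_max_left k l) h
  have h1 := T.eq_one_mono (le_max_right k l) hl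
  rw [h0] at h1
  exact zero_ne_one h1

lemma x_per {k : ℕ} {n : ℤ} (h : ¬ IsHole (T.β k) n) (m : ℤ) : T.x (n + m * T.p k) = T.x n := by
  have hm := periodic_add_mul (T.per k) n m
  by_cases h0 : T.β k n = 0
  · rw [T.x_of_eq_zero h0, T.x_of_eq_zero (hm.trans h0)]
  · have h1 : T.β k n = 1 := by
      by_contra h1
      exact h ⟨h0, h1⟩
    rw [T.x_of_eq_one h1, T.x_of_eq_one (hm.trans h1)]

lemma not_isHole (n : ℤ) : ¬ IsHole (T.β (n.natAbs + 1)) n := by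
  refine (T.refines n.natAbs).filled n ?_
  have := T.lt_p n.natAbs
  change |n| < (T.p n.natAbs : ℤ)
  rw [Int.abs_eq_natAbs]
  exact_mod_cast this

lemma isToeplitz_x : IsToeplitz T.x := fun k =>
  ⟨_, T.p_pos _, fun n => T.x_per (T.not_isHole k) n⟩

open Classical in
/-- The number of holes of stage `k + 1` in a window of length equal to the period. -/
lemma card_isHole_le (k : ℕ) (m : ℤ) :
    ∑ i ∈ Finset.range (T.p (k + 1)), (if IsHole (T.β (k + 1)) (m + i) then (1 : ℝ) else 0)
      ≤ T.q k := by
  rw [p_succ, sum_range_mul_eq (fun i => if IsHole (T.β (k + 1)) (m + i) then (1 : ℝ) else 0),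
    Finset.sum_comm]
  calc _ ≤ ∑ j ∈ Finset.range (T.q k), (1 : ℝ) := by
        refine Finset.sum_le_sum fun j _ => ?_
        rw [Finset.sum_boole]
        norm_cast
        rw [Finset.card_le_one]
        intro a ha b hb
        simp only [Finset.mem_filter, Finset.mem_range] at ha hb
        by_contra hab
        have := (T.refines k).gap _ _ ha.2 hb.2 (by omega)
        change (T.p k : ℤ) ≤ _ at this
        rw [le_abs] at this
        omega
    _ = T.q k := by simp

lemma toeplitzDelta_ge (k : ℕ) : 1 - 1 / (T.p k : ℝ) ≤ toeplitzDelta T.x (T.p (k + 1)) := by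
  classical
  have hp : (0 : ℝ) < T.p k := by exact_mod_cast T.p_pos k
  have hp' : (0 : ℝ) < T.p (k + 1) := by exact_mod_cast T.p_pos (k + 1)
  rw [toeplitzDelta, le_div_iff₀ hp']
  have h1 := T.card_isHole_le k 0
  simp only [zero_add] at h1
  rw [Finset.sum_boole] at h1
  have h2 : (Finset.range (T.p (k + 1))).card
      = ((Finset.range (T.p (k + 1))).filter fun i : ℕ => IsHole (T.β (k + 1)) i).card
        + ((Finset.range (T.p (k + 1))).filter fun i : ℕ => ¬ IsHole (T.β (k + 1)) i).card :=
    (Finset.card_filter_add_card_filter_not _).symm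
  set S := {j : ℤ | 0 ≤ j ∧ j < (T.p (k + 1) : ℤ) ∧
    ∀ n : ℤ, T.x (j + n * T.p (k + 1)) = T.x j} with hS
  have hfin : S.Finite := (Set.finite_Ico (0 : ℤ) (T.p (k + 1))).subset
    fun j hj => ⟨hj.1, hj.2.1⟩
  have h3 : ((Finset.range (T.p (k + 1))).filter fun i : ℕ => ¬ IsHole (T.β (k + 1)) i).card
      ≤ S.ncard := by
    rw [← Set.ncard_coe_finset, ← Set.ncard_image_of_injective _ (Nat.cast_injective (R := ℤ))]
    refine Set.ncard_le_ncard ?_ hfin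
    rintro _ ⟨i, hi, rfl⟩
    simp only [Finset.coe_filter, Finset.mem_range, Set.mem_ofPred_eq] at hi
    exact ⟨by omega, by exact_mod_cast hi.1, fun n => T.x_per hi.2 n⟩
  rw [Finset.card_range] at h2
  have h2' := congrArg (Nat.cast : ℕ → ℝ) h2
  push_cast at h2'
  have h3' : (_ : ℝ) ≤ _ := Nat.cast_le.2 h3
  have h4 : 1 / (T.p k : ℝ) * T.p (k + 1) = T.q k := by
    rw [p_succ]; push_cast; field_simp
  rw [sub_mul, h4]
  linarith

lemma toeplitzDelta_le_one {A : Type*} (x : ℤ → A) (p : ℕ) : toeplitzDelta x p ≤ 1 := by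
  refine div_le_one_of_le₀ ?_ (Nat.cast_nonneg p)
  norm_cast
  calc _ ≤ (Set.Ico (0 : ℤ) p).ncard :=
        Set.ncard_le_ncard (fun j hj => ⟨hj.1, hj.2.1⟩) (Set.finite_Ico _ _)
    _ = p := by
        rw [← Finset.coe_Ico, Set.ncard_coe_finset]; simp

lemma tendsto_p : Filter.Tendsto (fun k => (T.p k : ℝ)) Filter.atTop Filter.atTop := by
  refine tendsto_natCast_atTop_atTop.comp (Filter.tendsto_atTop_mono (fun k => (T.lt_p k).le) ?_)
  exact Filter.tendsto_id

lemma isRegularToeplitz_x : IsRegularToeplitz T.x := by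
  refine ⟨T.isToeplitz_x, ?_⟩
  have hb : BddAbove {d : ℝ | ∃ p : ℕ, 1 ≤ p ∧ d = toeplitzDelta T.x p} :=
    ⟨1, by rintro d ⟨p, -, rfl⟩; exact toeplitzDelta_le_one _ _⟩
  refine le_antisymm (csSup_le ⟨_, 1, le_rfl, rfl⟩ ?_) ?_
  · rintro d ⟨p, -, rfl⟩; exact toeplitzDelta_le_one _ _
  · have h : Filter.Tendsto (fun k => 1 - 1 / (T.p k : ℝ)) Filter.atTop (𝓝 (1 - 0)) := by
      simp only [one_div]
      exact tendsto_const_nhds.sub (tendsto_inv_atTop_zero.comp T.tendsto_p)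
    rw [sub_zero] at h
    refine le_of_tendsto h (Filter.Eventually.of_forall fun k => ?_)
    exact (T.toeplitzDelta_ge k).trans (le_csSup hb ⟨_, T.p_pos _, rfl⟩)

/-! ### Uniform averages -/

/-- The averages of `F` over windows of length `p k` converge to `α`, uniformly in the window. -/
def UniformMean (F : ℤ → ℝ) (α : ℝ) : Prop :=
  ∀ ε > 0, ∃ K₀, ∀ K ≥ K₀, ∀ m : ℤ,
    |∑ i ∈ Finset.range (T.p K), F (m + i) - α * T.p K| ≤ ε * T.p K

variable {T}

lemma UniformMean.add {F G : ℤ → ℝ} {α γ : ℝ} (hF : T.UniformMean F α) (hG : T.UniformMean G γ) :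
    T.UniformMean (fun i => F i + G i) (α + γ) := by
  intro ε hε
  obtain ⟨K₁, h₁⟩ := hF (ε / 2) (by positivity)
  obtain ⟨K₂, h₂⟩ := hG (ε / 2) (by positivity)
  refine ⟨max K₁ K₂, fun K hK m => ?_⟩
  have e₁ := h₁ K (le_trans (le_max_left _ _) hK) m
  have e₂ := h₂ K (le_trans (le_max_right _ _) hK) m
  rw [Finset.sum_add_distrib]
  rw [abs_le] at *
  constructor <;> linarith [e₁.1, e₁.2, e₂.1, e₂.2]

lemma UniformMean.const_mul {F : ℤ → ℝ} {α : ℝ} (c : ℝ) (hF : T.UniformMean F α) :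
    T.UniformMean (fun i => c * F i) (c * α) := by
  intro ε hε
  obtain ⟨K₁, h₁⟩ := hF (ε / (|c| + 1)) (by positivity)
  refine ⟨K₁, fun K hK m => ?_⟩
  rw [← Finset.mul_sum, mul_assoc, ← mul_sub, abs_mul]
  have hp : (0 : ℝ) ≤ T.p K := Nat.cast_nonneg _
  calc |c| * _ ≤ |c| * (ε / (|c| + 1) * T.p K) := by gcongr; exact h₁ K hK m
    _ = (|c| / (|c| + 1)) * (ε * T.p K) := by ring
    _ ≤ 1 * (ε * T.p K) := by
        gcongr
        rw [div_le_one (by positivity)]; linarith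
    _ = ε * T.p K := one_mul _

lemma UniformMean.sum {ι : Type*} (s : Finset ι) {F : ι → ℤ → ℝ} {α : ι → ℝ}
    (h : ∀ j ∈ s, T.UniformMean (F j) (α j)) :
    T.UniformMean (fun i => ∑ j ∈ s, F j i) (∑ j ∈ s, α j) := by
  classical
  induction s using Finset.induction_on with
  | empty => intro ε hε; exact ⟨0, fun K _ m => by simp; positivity⟩
  | insert a s ha ih =>
    simp only [Finset.sum_insert ha]
    exact (h a (Finset.mem_insert_self _ _)).add
      (ih fun j hj => h j (Finset.mem_insert_of_mem hj))

lemma UniformMean.shift {F : ℤ → ℝ} {α : ℝ} (hF : T.UniformMean F α) (t : ℤ) :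
    T.UniformMean (fun i => F (i + t)) α := by
  intro ε hε
  obtain ⟨K₁, h₁⟩ := hF ε hε
  refine ⟨K₁, fun K hK m => ?_⟩
  have := h₁ K hK (m + t)
  simpa only [add_right_comm] using this

variable (T)

/-- The mass that stage `k` gives to a periodic weight does not change under refinement. -/
lemma sum_mul_β {k K : ℕ} (h : k ≤ K) {w : ℤ → ℝ} (hw : ∀ n, w (n + T.p k) = w n) (m : ℤ) :
    (∑ i ∈ Finset.range (T.p K), w (m + i) * T.β K (m + i)) * T.p k
      = (∑ i ∈ Finset.range (T.p k), w i * T.β k i) * T.p K := by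
  induction h with
  | refl =>
    rw [sum_range_add_of_periodic (f := fun i => w i * T.β k i)
      (fun n => by simp only [hw, T.per])]
  | @step K hK ih =>
    have hw' : ∀ n j : ℤ, w (n + j * T.p K) = w n := by
      intro n j
      obtain ⟨d, hd⟩ := T.p_dvd hK
      rw [hd]
      have := periodic_add_mul hw n (j * d)
      rw [← this]; congr 1; push_cast; ring
    have hs : ∀ n : ℤ, ∑ j ∈ Finset.range (T.q K), T.β (K + 1) (n + j * T.p K)
        = T.q K * T.β K n := (T.refines K).sum
    rw [p_succ, sum_range_mul_eq (fun i => w (m + i) * T.β (K + 1) (m + i))]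
    simp only [← add_assoc, hw', ← Finset.mul_sum, hs]
    push_cast
    rw [mul_left_comm, ← ih, Finset.sum_mul, Finset.sum_mul, Finset.mul_sum]
    exact Finset.sum_congr rfl fun i _ => by ring

/-- The Toeplitz sequence, with real values. -/
noncomputable def xr (n : ℤ) : ℝ := if T.x n then 1 else 0

open Classical in
lemma abs_xr_sub_β_le (k : ℕ) (n : ℤ) :
    |T.xr n - T.β k n| ≤ if IsHole (T.β k) n then 1 else 0 := by
  by_cases h : IsHole (T.β k) n
  · have h0 : 0 ≤ T.β k n := (T.stage k).nonneg n
    have h1 : T.β k n ≤ 1 := (T.stage k).le_one n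
    rw [if_pos h, xr, abs_le]
    split_ifs <;> constructor <;> linarith
  · rw [if_neg h]
    by_cases h0 : T.β k n = 0
    · simp [xr, T.x_of_eq_zero h0, h0]
    · have h1 : T.β k n = 1 := by
        by_contra h1
        exact h ⟨h0, h1⟩
      simp [xr, T.x_of_eq_one h1, h1]

lemma exists_bound_of_periodic {w : ℤ → ℝ} {p : ℕ} (hp : 0 < p) (hw : ∀ n, w (n + p) = w n) :
    ∃ C, 0 ≤ C ∧ ∀ n, |w n| ≤ C := by
  refine ⟨∑ i ∈ Finset.range p, |w i|, Finset.sum_nonneg fun _ _ => abs_nonneg _, fun n => ?_⟩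
  rw [← periodic_emod hw n]
  have hp' : (0 : ℤ) < p := by exact_mod_cast hp
  have h1 := Int.emod_lt_of_pos n hp'
  lift n % (p : ℤ) to ℕ using Int.emod_nonneg n hp'.ne' with m
  exact Finset.single_le_sum (f := fun i : ℕ => |w i|) (fun _ _ => abs_nonneg _)
    (Finset.mem_range.2 (by exact_mod_cast h1))

lemma uniformMean_mul_xr {k : ℕ} {w : ℤ → ℝ} (hw : ∀ n, w (n + T.p k) = w n) :
    T.UniformMean (fun i => w i * T.xr i)
      ((∑ i ∈ Finset.range (T.p k), w i * T.β k i) / T.p k) := by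
  classical
  obtain ⟨C, hC0, hC⟩ := exists_bound_of_periodic (T.p_pos k) hw
  intro ε hε
  obtain ⟨K₀, hK₀⟩ := Filter.eventually_atTop.1 (T.tendsto_p.eventually_ge_atTop (C / ε))
  refine ⟨max k K₀ + 1, fun K hK m => ?_⟩
  obtain ⟨K, rfl⟩ : ∃ L, K = L + 1 := ⟨K - 1, by omega⟩
  have hkK : k ≤ K + 1 := by omega
  have hpk : (T.p k : ℝ) ≠ 0 := by exact_mod_cast (T.p_pos k).ne'
  have hpK : (0 : ℝ) < T.p K := by exact_mod_cast T.p_pos K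
  have hK1 := hK₀ K (by omega)
  have e1 : (∑ i ∈ Finset.range (T.p k), w i * T.β k i) / T.p k * T.p (K + 1)
      = ∑ i ∈ Finset.range (T.p (K + 1)), w (m + i) * T.β (K + 1) (m + i) := by
    rw [div_mul_eq_mul_div, ← T.sum_mul_β hkK hw m, mul_div_cancel_right₀ _ hpk]
  rw [e1, ← Finset.sum_sub_distrib]
  calc _ ≤ ∑ i ∈ Finset.range (T.p (K + 1)),
        C * (if IsHole (T.β (K + 1)) (m + i) then (1 : ℝ) else 0) := by
        refine (Finset.abs_sum_le_sum_abs _ _).trans (Finset.sum_le_sum fun i _ => ?_)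
        rw [← mul_sub, abs_mul]
        exact mul_le_mul (hC _) (T.abs_xr_sub_β_le _ _) (abs_nonneg _) hC0
    _ ≤ C * T.q K := by
        rw [← Finset.mul_sum]
        exact mul_le_mul_of_nonneg_left (T.card_isHole_le K m) hC0
    _ ≤ (ε * T.p K) * T.q K := by
        gcongr
        rwa [div_le_iff₀' hε] at hK1
    _ = ε * T.p (K + 1) := by rw [p_succ]; push_cast; ring

lemma uniformMean_periodic {k : ℕ} {w : ℤ → ℝ} (hw : ∀ n, w (n + T.p k) = w n) :
    T.UniformMean w ((∑ i ∈ Finset.range (T.p k), w i) / T.p k) := by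
  intro ε hε
  refine ⟨k, fun K hK m => ?_⟩
  have hpk : (T.p k : ℝ) ≠ 0 := by exact_mod_cast (T.p_pos k).ne'
  obtain ⟨d, hd⟩ := T.p_dvd hK
  have : ∑ i ∈ Finset.range (T.p K), w (m + i)
      = (∑ i ∈ Finset.range (T.p k), w i) / T.p k * T.p K := by
    rw [hd, mul_comm (T.p k) d, sum_range_mul_eq (fun i => w (m + i))]
    have e : ∀ i j : ℤ, w (m + (i + j * T.p k)) = w (m + i) := fun i j => by
      rw [← add_assoc, periodic_add_mul hw]
    simp only [e, Finset.sum_const, Finset.card_range, nsmul_eq_mul, ← Finset.mul_sum]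
    rw [sum_range_add_of_periodic hw]
    push_cast
    field_simp
  rw [this, sub_self, abs_zero]
  positivity

end Tower

/-- The shiftBy of a sequence by `m`. -/
def shiftBy (m : ℤ) (z : Cantor) : Cantor := fun n => z (n + m)

lemma shiftBy_shiftBy (m n : ℤ) (z : Cantor) :
    shiftBy m (shiftBy n z) = shiftBy (m + n) z := by
  funext j; simp only [shiftBy, add_assoc]

lemma iterate_shift (n : ℕ) (z : Cantor) : shift^[n] z = shiftBy n z := by
  induction n with
  | zero => funext j; simp [shiftBy]
  | succ n ih =>
    rw [Function.iterate_succ_apply', ih]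
    funext j
    simp only [shift, shiftBy]
    congr 1; push_cast; ring

lemma zOrbit_shift (x : Cantor) : zOrbit shift x = Set.range fun m : ℤ => shiftBy m x := by
  ext y
  simp only [zOrbit, Set.mem_ofPred_eq, Set.mem_range, iterate_shift]
  constructor
  · rintro ⟨n, rfl | rfl⟩
    · exact ⟨n, rfl⟩
    · refine ⟨-n, ?_⟩
      rw [shiftBy_shiftBy]
      funext j; simp [shiftBy]
  · rintro ⟨m, rfl⟩
    obtain ⟨n, rfl | rfl⟩ := m.eq_nat_or_neg
    · exact ⟨n, Or.inl rfl⟩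
    · refine ⟨n, Or.inr ?_⟩
      rw [shiftBy_shiftBy]
      funext j; simp [shiftBy]

lemma continuous_shiftBy (m : ℤ) : Continuous (shiftBy m) :=
  continuous_pi fun n => continuous_apply (n + m)

/-- `f` depends only on the coordinates in `[-M, M]`. -/
def IsWindow (f : Cantor → ℤ) (M : ℕ) : Prop :=
  ∀ z z' : Cantor, (∀ n : ℤ, |n| ≤ M → z n = z' n) → f z = f z'

lemma IsWindow.continuous {f : Cantor → ℤ} {M : ℕ} (h : IsWindow f M) : Continuous f := by
  refine IsLocallyConstant.continuous ((IsLocallyConstant.iff_eventually_eq f).2 fun z => ?_)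
  have : ∀ᶠ z' : Cantor in 𝓝 z, ∀ n ∈ Finset.Icc (-(M : ℤ)) M, z' n = z n := by
    rw [Filter.eventually_all_finset]
    intro n _
    have := (continuous_apply (A := fun _ : ℤ => Bool) n).tendsto z
    rw [nhds_discrete Bool, Filter.tendsto_pure] at this
    exact this
  filter_upwards [this] with z' hz'
  exact h _ _ fun n hn => hz' n (Finset.mem_Icc.2 (abs_le.1 hn))

lemma IsWindow.continuous_real {f : Cantor → ℤ} {M : ℕ} (h : IsWindow f M) :
    Continuous fun z => (f z : ℝ) := continuous_of_discreteTopology.comp h.continuous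

lemma IsWindow.integrable {f : Cantor → ℤ} {M : ℕ} (h : IsWindow f M) (ν : Measure Cantor)
    [IsFiniteMeasure ν] : Integrable (fun z => (f z : ℝ)) ν :=
  h.continuous_real.integrable_of_hasCompactSupport (HasCompactSupport.of_compactSpace _)

lemma IsWindow.comp_shiftBy {f : Cantor → ℤ} {M : ℕ} (h : IsWindow f M) (m : ℤ) :
    IsWindow (fun z => f (shiftBy m z)) (M + m.natAbs) := by
  intro z z' hz
  refine h _ _ fun n hn => hz _ ?_
  have := abs_add_le n m
  push_cast
  omega

lemma exists_isWindow {X : Set Cantor} (hX : IsCompact X) (f : C(X, ℤ)) :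
    ∃ g : Cantor → ℤ, ∃ M, IsWindow g M ∧ ∀ z : X, f z = g z := by
  classical
  have hXc : CompactSpace X := isCompact_iff_compactSpace.1 hX
  have loc : ∀ z : X, ∃ M : ℕ, ∃ U ∈ 𝓝 z, (∀ y ∈ U, f y = f z ∧
      ∀ y' : X, (∀ n : ℤ, |n| ≤ M → (y : Cantor) n = (y' : Cantor) n) → f y' = f z) := by
    intro z
    have h1 : f ⁻¹' {f z} ∈ 𝓝 z := f.continuous.continuousAt.preimage_mem_nhds (by simp)
    rw [nhds_subtype, Filter.mem_comap] at h1
    obtain ⟨U, hU, hUf⟩ := h1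
    rw [nhds_pi, Filter.mem_pi] at hU
    obtain ⟨I, hI, t, ht, htU⟩ := hU
    have hfin : I.pi t ∈ 𝓝 (z : Cantor) := set_pi_mem_nhds hI fun i _ => ht i
    refine ⟨hI.toFinset.sup Int.natAbs, Subtype.val ⁻¹' I.pi t,
      continuous_subtype_val.continuousAt.preimage_mem_nhds hfin, fun y hy => ⟨hUf (htU hy), ?_⟩⟩
    intro y' hy'
    refine hUf (htU fun i hi => ?_)
    rw [← hy' i]
    · exact hy i hi
    · rw [Int.abs_eq_natAbs]
      exact_mod_cast Finset.le_sup (f := Int.natAbs) (hI.mem_toFinset.2 hi)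
  choose M U hU hUf using loc
  obtain ⟨t, ht⟩ := CompactSpace.elim_nhds_subcover U hU
  have key : ∀ y y' : X, (∀ n : ℤ, |n| ≤ (t.sup M : ℕ) → (y : Cantor) n = (y' : Cantor) n) →
      f y = f y' := by
    intro y y' h
    have hy : y ∈ ⋃ z ∈ t, U z := by rw [ht]; trivial
    simp only [Set.mem_iUnion] at hy
    obtain ⟨z, hz, hyz⟩ := hy
    obtain ⟨h1, h2⟩ := hUf z y hyz
    rw [h1, h2 y' fun n hn => h n (hn.trans (by exact_mod_cast Finset.le_sup hz))]
  let P : Cantor → X → Prop := fun z y => ∀ n : ℤ, |n| ≤ (t.sup M : ℕ) → (y : Cantor) n = z n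
  refine ⟨fun z => if h : ∃ y, P z y then f h.choose else 0, t.sup M, ?_, ?_⟩
  · intro z z' hz
    have e : P z = P z' := by
      funext y
      exact propext (forall₂_congr fun n hn => by rw [hz n hn])
    simp only [e]
  · intro z
    have h : ∃ y, P z y := ⟨z, fun n _ => rfl⟩
    simp only [dif_pos h]
    exact key _ _ fun n hn => (h.choose_spec n hn).symm

lemma measure_ext_of_isWindow {μ ν : Measure Cantor} [IsProbabilityMeasure μ]
    [IsProbabilityMeasure ν]
    (h : ∀ f M, IsWindow f M → ∫ z, (f z : ℝ) ∂μ = ∫ z, (f z : ℝ) ∂ν) : μ = ν := by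
  classical
  refine ext_of_generate_finite _ generateFrom_measurableCylinders.symm
    isPiSystem_measurableCylinders (fun S hS => ?_) (by simp)
  have hSm : MeasurableSet S := .of_mem_measurableCylinders hS
  obtain ⟨I, A, -, rfl⟩ := (mem_measurableCylinders S).1 hS
  have hw : IsWindow (fun z => if z ∈ cylinder I A then 1 else 0) (I.sup Int.natAbs) := by
    intro z z' hz
    have : I.restrict z = I.restrict z' := by
      funext i
      refine hz i ?_
      rw [Int.abs_eq_natAbs]
      exact_mod_cast Finset.le_sup (f := Int.natAbs) i.2
    simp only [mem_cylinder, this]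
  have e : ∀ ρ : Measure Cantor, ∫ z, ((if z ∈ cylinder I A then 1 else 0 : ℤ) : ℝ) ∂ρ
      = ρ.real (cylinder I A) := by
    intro ρ
    rw [← integral_indicator_one hSm]
    refine integral_congr_ae (Filter.Eventually.of_forall fun z => ?_)
    by_cases hz : z ∈ cylinder I A <;> simp [hz]
  have := h _ _ hw
  rw [e, e] at this
  exact (measureReal_eq_measureReal_iff).1 this

namespace Tower

variable {V : Submodule ℚ ℝ} (T : Tower V)

/-- The Toeplitz subshift generated by the limit sequence. -/
def X : Set Cantor := closure (zOrbit shift T.x)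

lemma isClosed_X : IsClosed T.X := isClosed_closure

lemma shiftBy_mem_X (m : ℤ) : shiftBy m T.x ∈ T.X :=
  subset_closure (by rw [zOrbit_shift]; exact ⟨m, rfl⟩)

lemma X_induction {P : Cantor → Prop} (hP : IsClosed {z | P z}) (h : ∀ m, P (shiftBy m T.x)) :
    ∀ z ∈ T.X, P z := by
  have : T.X ⊆ {z | P z} := by
    refine closure_minimal ?_ hP
    rw [zOrbit_shift]
    rintro _ ⟨m, rfl⟩
    exact h m
  exact this

open Classical in
/-- Along the orbit of `T.x`, a window function is affine in the letters of `T.x`, with periodic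
coefficients: a window meets at most one hole of a sufficiently late stage. -/
lemma exists_periodic_coeff {f : Cantor → ℤ} {M : ℕ} (hf : IsWindow f M) :
    ∃ (k : ℕ) (c : ℤ → ℤ) (d : ℤ → ℤ → ℤ), (∀ i, c (i + T.p k) = c i) ∧
      (∀ s i, d s (i + T.p k) = d s i) ∧ ∀ i, (f (shiftBy i T.x) : ℝ) = c i
        + ∑ s ∈ Finset.Icc (-(M : ℤ)) M, (d s i : ℝ) * T.xr (i + s) := by
  obtain ⟨k, hgap⟩ : ∃ k, ∀ n n' : ℤ, IsHole (T.β k) n → IsHole (T.β k) n' → n ≠ n' →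
      (2 * M : ℤ) < |n - n'| := by
    refine ⟨2 * M + 1, fun n n' h h' hne => ?_⟩
    have h1 : (T.p (2 * M) : ℤ) ≤ |n - n'| := (T.refines (2 * M)).gap n n' h h' hne
    have h2 := T.lt_p (2 * M)
    omega
  let u₀ : Cantor := fun n => decide (T.β k n = 1)
  let u₁ : Cantor := fun n => decide (T.β k n ≠ 0)
  let d : ℤ → ℤ → ℤ := fun s i =>
    if IsHole (T.β k) (i + s) then f (shiftBy i u₁) - f (shiftBy i u₀) else 0
  have tp₀ : ∀ i, shiftBy (i + T.p k) u₀ = shiftBy i u₀ := fun i => by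
    funext n; simp only [shiftBy, u₀, ← add_assoc, T.per]
  have tp₁ : ∀ i, shiftBy (i + T.p k) u₁ = shiftBy i u₁ := fun i => by
    funext n; simp only [shiftBy, u₁, ← add_assoc, T.per]
  have hd : ∀ s i, d s (i + T.p k) = d s i := fun s i => by
    have hi : IsHole (T.β k) (i + T.p k + s) ↔ IsHole (T.β k) (i + s) := by
      rw [IsHole, IsHole, add_right_comm, T.per]
    simp only [d, hi, tp₀, tp₁]
  have hx : ∀ n, ¬ IsHole (T.β k) n → T.x n = u₀ n ∧ T.x n = u₁ n := by
    intro n hn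
    by_cases h0 : T.β k n = 0
    · simp [T.x_of_eq_zero h0, u₀, u₁, h0]
    · have h1 : T.β k n = 1 := by
        by_contra h1
        exact hn ⟨h0, h1⟩
      simp [T.x_of_eq_one h1, u₀, u₁, h1]
  refine ⟨k, fun i => f (shiftBy i u₀), d, fun i => by simp only [tp₀], hd, fun i => ?_⟩
  by_cases h : ∃ s ∈ Finset.Icc (-(M : ℤ)) M, IsHole (T.β k) (i + s)
  · obtain ⟨s, hs, hh⟩ := h
    have huniq : ∀ n : ℤ, |n| ≤ M → n ≠ s → ¬ IsHole (T.β k) (i + n) := by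
      intro n hn hne hh'
      have := hgap _ _ hh hh' (by omega)
      rw [Finset.mem_Icc] at hs
      rw [abs_le] at hn
      rw [lt_abs] at this
      omega
    rw [Finset.sum_eq_single_of_mem s hs]
    · by_cases hxs : T.x (i + s) = true
      · have : f (shiftBy i T.x) = f (shiftBy i u₁) := by
          refine hf _ _ fun n hn => ?_
          simp only [shiftBy, add_comm n i]
          by_cases hns : n = s
          · rw [hns, hxs]
            simpa [u₁] using hh.1
          · exact (hx _ (huniq n hn hns)).2
        simp [this, d, hh, xr, hxs]
      · have : f (shiftBy i T.x) = f (shiftBy i u₀) := by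
          refine hf _ _ fun n hn => ?_
          simp only [shiftBy, add_comm n i]
          by_cases hns : n = s
          · rw [hns, Bool.eq_false_of_not_eq_true hxs]
            simpa [u₀] using hh.2
          · exact (hx _ (huniq n hn hns)).1
        simp [this, xr, hxs]
    · intro n hn hne
      rw [Finset.mem_Icc] at hn
      simp [d, huniq n (abs_le.2 hn) hne]
  · push Not at h
    rw [Finset.sum_eq_zero, add_zero]
    · congr 1
      refine hf _ _ fun n hn => ?_
      simp only [shiftBy, add_comm n i]
      exact (hx _ (h n (Finset.mem_Icc.2 (abs_le.1 hn)))).1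
    · intro s hs
      simp [d, h s hs]

lemma exists_uniformMean (hV : (1 : ℝ) ∈ V) {f : Cantor → ℤ} {M : ℕ} (hf : IsWindow f M) :
    ∃ α ∈ V, T.UniformMean (fun i => (f (shiftBy i T.x) : ℝ)) α := by
  obtain ⟨k, c, d, hc, hd, hF⟩ := T.exists_periodic_coeff hf
  have hint : ∀ (n : ℤ) (y : ℝ), y ∈ V → (n : ℝ) * y ∈ V := fun n y hy => by
    simpa [Algebra.smul_def] using V.smul_mem (n : ℚ) hy
  have hdiv : ∀ (n : ℕ) (y : ℝ), y ∈ V → y / n ∈ V := fun n y hy => by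
    have := V.smul_mem ((n : ℚ)⁻¹) hy
    rw [Algebra.smul_def] at this
    simpa [div_eq_inv_mul] using this
  have hd' : ∀ s i, (d s (i + T.p k - s) : ℝ) = d s (i - s) := fun s i => by
    rw [← hd s (i - s)]; congr 2; ring
  have h1 := T.uniformMean_periodic (k := k) (w := fun i => (c i : ℝ))
    (fun n => by simp only [hc])
  have h2 := UniformMean.sum (Finset.Icc (-(M : ℤ)) M) fun s _ =>
    (T.uniformMean_mul_xr (k := k) (w := fun i => (d s (i - s) : ℝ)) (hd' s)).shift s
  have h3 := h1.add h2
  simp only [add_sub_cancel_right, ← hF] at h3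
  refine ⟨_, V.add_mem (hdiv _ _ (V.sum_mem fun i _ => ?_))
    (V.sum_mem fun s _ => hdiv _ _ (V.sum_mem fun i _ => ?_)), h3⟩
  · simpa using hint (c i) 1 hV
  · exact hint (d s (i - s)) _ ((T.stage k).mem i)

lemma exists_recognition (k : ℕ) : ∃ M : ℕ, ∀ i i' : ℤ,
    (∀ n : ℤ, |n| ≤ M → T.x (n + i) = T.x (n + i')) → (T.p k : ℤ) ∣ i - i' := by
  induction k with
  | zero => exact ⟨0, fun i i' _ => by rw [p, T.p_zero]; simp⟩
  | succ k ih =>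
    obtain ⟨M, hM⟩ := ih
    obtain ⟨r, a, h0, h1, h2, huniq⟩ := (T.refines k).recog
    change T.β (k + 1) (r + a * T.p k) = 0 at h0
    change T.β (k + 1) (r + (a + 1) * T.p k) = 1 at h1
    change T.β (k + 1) (r + (a + 2) * T.p k) = 1 at h2
    change ∀ b : ℤ, T.β (k + 1) (r + b * T.p k) ≠ 1 → T.β (k + 1) (r + (b + 1) * T.p k) ≠ 0 →
      T.β (k + 1) (r + (b + 2) * T.p k) ≠ 0 → _ at huniq
    refine ⟨M + 3 * T.p (k + 1), fun i i' h => ?_⟩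
    have hp : (0 : ℤ) < T.p k := by exact_mod_cast T.p_pos k
    have hp' : (0 : ℤ) < T.p (k + 1) := by exact_mod_cast T.p_pos (k + 1)
    have hle : (T.p k : ℤ) ≤ T.p (k + 1) := by exact_mod_cast T.p_mono (Nat.le_succ k)
    obtain ⟨e, he⟩ := hM i i' fun n hn => h n (by push_cast; omega)
    obtain ⟨n, t, hn0, hn1, hnt⟩ : ∃ n t : ℤ, 0 ≤ n ∧ n < T.p (k + 1) ∧
        n + i = r + a * T.p k + t * T.p (k + 1) := by
      refine ⟨(r + a * T.p k - i) % T.p (k + 1), -((r + a * T.p k - i) / T.p (k + 1)),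
        Int.emod_nonneg _ hp'.ne', Int.emod_lt_of_pos _ hp', ?_⟩
      have := Int.emod_add_mul_ediv (r + a * T.p k - i) (T.p (k + 1))
      linear_combination this
    have hps : (T.p (k + 1) : ℤ) = T.q k * T.p k := by exact_mod_cast T.p_succ k
    -- the position in question, seen from the second window
    obtain ⟨b, hb⟩ : ∃ b : ℤ, n + i' = r + b * T.p k :=
      ⟨a + t * T.q k - e, by linear_combination hnt - he + t * hps⟩
    have x0 : T.x (n + i) = false := T.x_of_eq_zero (k := k + 1) (by
      rw [hnt, periodic_add_mul (T.per _), h0])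
    have x1 : T.x (n + T.p k + i) = true := T.x_of_eq_one (k := k + 1) (by
      rw [show n + T.p k + i = r + (a + 1) * T.p k + t * T.p (k + 1) by linear_combination hnt,
        periodic_add_mul (T.per _), h1])
    have x2 : T.x (n + 2 * T.p k + i) = true := T.x_of_eq_one (k := k + 1) (by
      rw [show n + 2 * T.p k + i = r + (a + 2) * T.p k + t * T.p (k + 1) by
        linear_combination hnt, periodic_add_mul (T.per _), h2])
    rw [h n (by rw [abs_of_nonneg] <;> omega)] at x0
    rw [h _ (by rw [abs_of_nonneg] <;> omega)] at x1 x2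
    obtain ⟨c, hc⟩ := huniq b
      (fun hh => by
        rw [← hb] at hh
        rw [T.x_of_eq_one hh] at x0
        exact Bool.noConfusion x0)
      (fun hh => by
        rw [show r + (b + 1) * T.p k = n + T.p k + i' by linear_combination -hb] at hh
        rw [T.x_of_eq_zero hh] at x1
        exact Bool.noConfusion x1)
      (fun hh => by
        rw [show r + (b + 2) * T.p k = n + 2 * T.p k + i' by linear_combination -hb] at hh
        rw [T.x_of_eq_zero hh] at x2
        exact Bool.noConfusion x2)
    exact ⟨t - c, by linear_combination hnt - hb - T.p k * hc + c * hps⟩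

open Classical in
/-- The indicator of a residue class modulo `p k` is the trace of a window function. -/
lemma exists_isWindow_residue (k : ℕ) (r : ℤ) : ∃ f : Cantor → ℤ, ∃ M, IsWindow f M ∧
    ∀ i, f (shiftBy i T.x) = if (T.p k : ℤ) ∣ i - r then 1 else 0 := by
  obtain ⟨M, hM⟩ := T.exists_recognition k
  refine ⟨fun z => if ∃ i : ℤ, (T.p k : ℤ) ∣ i - r ∧ ∀ n : ℤ, |n| ≤ M → z n = T.x (n + i)
    then 1 else 0, M, ?_, ?_⟩
  · intro z z' hz
    have : ∀ i : ℤ, (∀ n : ℤ, |n| ≤ M → z n = T.x (n + i)) ↔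
        ∀ n : ℤ, |n| ≤ M → z' n = T.x (n + i) :=
      fun i => forall₂_congr fun n hn => by rw [hz n hn]
    simp only [this]
  · intro i
    refine if_congr ⟨?_, fun h => ⟨i, h, fun n _ => rfl⟩⟩ rfl rfl
    rintro ⟨j, hj, hn⟩
    have := dvd_add (hM i j hn) hj
    rwa [sub_add_sub_cancel] at this

open Classical in
lemma sum_residue (k : ℕ) (n : ℤ) (g : ℤ → ℝ) (hg : ∀ n, g (n + T.p k) = g n) :
    ∑ i ∈ Finset.range (T.p k), (if (T.p k : ℤ) ∣ i - n then (1 : ℝ) else 0) * g i = g n := by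
  have hp : (0 : ℤ) < T.p k := by exact_mod_cast T.p_pos k
  have h := sum_range_add_of_periodic (q := T.p k)
    (f := fun i => (if (T.p k : ℤ) ∣ i - n then (1 : ℝ) else 0) * g i)
    (fun i => by rw [hg, add_sub_right_comm]; simp) n
  rw [← h, Finset.sum_eq_single_of_mem 0 (Finset.mem_range.2 (T.p_pos k))]
  · simp
  · intro j hj hj0
    rw [if_neg, zero_mul]
    rw [add_sub_cancel_left]
    intro hd
    have := Nat.le_of_dvd (Nat.pos_of_ne_zero hj0) (by exact_mod_cast hd)
    rw [Finset.mem_range] at hj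
    omega

lemma exists_isWindow_uniformMean {w : ℝ} (hw : w ∈ V) : ∃ f : Cantor → ℤ, ∃ M, IsWindow f M ∧
    T.UniformMean (fun i => (f (shiftBy i T.x) : ℝ)) w := by
  classical
  obtain ⟨k, rfl⟩ := T.surj w hw
  obtain ⟨n, t, hnt⟩ := (T.refines k).value
  change T.β (k + 1) n = T.v k + t at hnt
  obtain ⟨f, M, hfM, hf⟩ := T.exists_isWindow_residue (k + 1) n
  obtain ⟨f', M', hfM', hf'⟩ := T.exists_isWindow_residue t.den 0
  obtain ⟨d, hd⟩ := T.dvd_p t.den_pos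
  have hp : (T.p (k + 1) : ℝ) ≠ 0 := by exact_mod_cast (T.p_pos _).ne'
  have hp' : (T.p t.den : ℝ) ≠ 0 := by exact_mod_cast (T.p_pos _).ne'
  have per : ∀ k n i, (if (T.p k : ℤ) ∣ i + T.p k - n then (1 : ℝ) else 0)
      = if (T.p k : ℤ) ∣ i - n then 1 else 0 := fun k n i => by
    rw [add_sub_right_comm]; simp
  have m1 := (T.uniformMean_mul_xr (k := k + 1)
    (w := fun i => if (T.p (k + 1) : ℤ) ∣ i - n then (1 : ℝ) else 0)
    (fun i => per _ _ i)).const_mul (T.p (k + 1))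
  rw [T.sum_residue _ _ _ (T.per _), mul_div_cancel₀ _ hp, hnt] at m1
  have m2 := (T.uniformMean_periodic (k := t.den)
    (w := fun i => if (T.p t.den : ℤ) ∣ i - 0 then (1 : ℝ) else 0)
    (fun i => per _ _ i)).const_mul (-(t.num * d))
  have s2 := T.sum_residue t.den 0 (fun _ => 1) (fun _ => rfl)
  simp only [mul_one] at s2
  rw [s2] at m2
  have m3 := m1.add m2
  have hval : T.v k + t + -((t.num : ℝ) * d) * (1 / T.p t.den) = T.v k := by
    have hden : (t.den : ℝ) ≠ 0 := by exact_mod_cast t.den_pos.ne'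
    have ht : (t : ℝ) = t.num / t.den := Rat.cast_def t
    have hd' : (T.p t.den : ℝ) = t.den * d := by exact_mod_cast hd
    rw [hd'] at hp'
    have hd0 : (d : ℝ) ≠ 0 := right_ne_zero_of_mul hp'
    rw [ht, hd']
    field_simp
    ring
  rw [hval] at m3
  refine ⟨fun z => T.p (k + 1) * (f z * (if z 0 then 1 else 0)) + -(t.num * d) * f' z,
    max M M', ?_, ?_⟩
  · intro z z' hz
    have e1 := hfM z z' fun n hn => hz n (hn.trans (by exact_mod_cast le_max_left M M'))
    have e2 := hfM' z z' fun n hn => hz n (hn.trans (by exact_mod_cast le_max_right M M'))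
    have e3 := hz 0 (by simp)
    simp only [e1, e2, e3]
  · convert m3 using 2 with i
    simp only [hf, hf', xr, shiftBy, zero_add]
    push_cast
    rfl

/-! ### The invariant measure -/

lemma measurable_shift : Measurable (shift : Cantor → Cantor) :=
  measurable_pi_lambda _ fun n => measurable_pi_apply (n + 1)

lemma integral_eq {ν : Measure Cantor} [IsProbabilityMeasure ν]
    (hν : MeasurePreserving shift ν ν) (hX : ν T.X = 1) {f : Cantor → ℤ} {M : ℕ}
    (hf : IsWindow f M) {α : ℝ} (hα : T.UniformMean (fun i => (f (shiftBy i T.x) : ℝ)) α) :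
    ∫ z, (f z : ℝ) ∂ν = α := by
  have htr : ∀ i : ℕ, ∫ z, (f (shiftBy i z) : ℝ) ∂ν = ∫ z, (f z : ℝ) ∂ν := by
    intro i
    have hi := hν.iterate i
    have : (shift^[i] : Cantor → Cantor) = shiftBy i := funext fun z => iterate_shift i z
    rw [this] at hi
    have h := integral_map hi.measurable.aemeasurable
      (hf.continuous_real.aestronglyMeasurable (μ := ν.map (shiftBy i)))
    rw [← h, hi.map_eq]
  have hae : ∀ᵐ z ∂ν, z ∈ T.X := by
    rw [← prob_compl_eq_zero_iff T.isClosed_X.measurableSet] at hX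
    exact hX
  refine eq_of_forall_dist_le fun ε hε => ?_
  obtain ⟨K, hK⟩ := hα ε hε
  replace hK := hK K le_rfl
  have hp : (0 : ℝ) < T.p K := by exact_mod_cast T.p_pos K
  let h : Cantor → ℝ := fun z => ∑ i ∈ Finset.range (T.p K), (f (shiftBy i z) : ℝ)
  have hcont : Continuous h := continuous_finsetSum _ fun i _ =>
    hf.continuous_real.comp (continuous_shiftBy i)
  have hX' : ∀ z ∈ T.X, |h z - α * T.p K| ≤ ε * T.p K := by
    refine T.X_induction (isClosed_le (hcont.sub continuous_const).abs continuous_const) ?_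
    intro m
    simpa only [h, shiftBy_shiftBy, add_comm] using hK m
  have hint : ∫ z, (h z - α * T.p K) ∂ν = (∫ z, (f z : ℝ) ∂ν - α) * T.p K := by
    have hi : ∀ i ∈ Finset.range (T.p K), Integrable (fun z => (f (shiftBy i z) : ℝ)) ν :=
      fun i _ => (hf.comp_shiftBy i).integrable ν
    rw [integral_sub (integrable_finsetSum _ hi) (integrable_const _), integral_finsetSum _ hi]
    simp only [htr, Finset.sum_const, Finset.card_range, nsmul_eq_mul, integral_const,
      probReal_univ, one_smul]
    ring
  have hb := norm_integral_le_of_norm_le_const (μ := ν) (f := fun z => h z - α * T.p K)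
    (C := ε * T.p K) (hae.mono fun z hz => by simpa using hX' z hz)
  rw [hint, probReal_univ, mul_one, norm_mul, Real.norm_of_nonneg hp.le] at hb
  rw [dist_eq_norm]
  exact le_of_mul_le_mul_right hb hp

/-- The empirical measure along the first `p k` points of the orbit. -/
noncomputable def empirical (k : ℕ) : ProbabilityMeasure Cantor :=
  ⟨((T.p k : NNReal)⁻¹ : NNReal) • ∑ i ∈ Finset.range (T.p k), Measure.dirac (shiftBy i T.x), by
    have hp : (T.p k : NNReal) ≠ 0 := by exact_mod_cast (T.p_pos k).ne'
    constructor
    simp only [Measure.smul_apply, Measure.coe_finsetSum, Finset.sum_apply, measure_univ,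
      Finset.sum_const, Finset.card_range, nsmul_eq_mul, mul_one]
    rw [ENNReal.smul_def, smul_eq_mul]
    exact_mod_cast inv_mul_cancel₀ hp⟩

lemma integral_empirical (k : ℕ) {f : Cantor → ℤ} {M : ℕ} (hf : IsWindow f M) :
    ∫ z, (f z : ℝ) ∂(T.empirical k : Measure Cantor)
      = (∑ i ∈ Finset.range (T.p k), (f (shiftBy i T.x) : ℝ)) / T.p k := by
  change ∫ z, (f z : ℝ) ∂(((T.p k : NNReal)⁻¹ : NNReal) •
    ∑ i ∈ Finset.range (T.p k), Measure.dirac (shiftBy i T.x)) = _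
  rw [integral_smul_nnreal_measure, integral_finsetSum_measure fun i _ => hf.integrable _]
  simp only [integral_dirac, NNReal.smul_def, smul_eq_mul, NNReal.coe_inv, NNReal.coe_natCast]
  rw [div_eq_inv_mul]

lemma empirical_X (k : ℕ) : (T.empirical k : Measure Cantor) T.X = 1 := by
  have : ∀ᵐ z ∂(T.empirical k : Measure Cantor), z ∈ T.X := by
    change ∀ᵐ z ∂(((T.p k : NNReal)⁻¹ : NNReal) •
      ∑ i ∈ Finset.range (T.p k), Measure.dirac (shiftBy i T.x)), z ∈ T.X
    refine Measure.ae_smul_measure ?_ _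
    rw [ae_iff]
    simp only [Measure.coe_finsetSum, Finset.sum_apply]
    refine Finset.sum_eq_zero fun i _ => ?_
    have hm : MeasurableSet {z | z ∉ T.X} := T.isClosed_X.measurableSet.compl
    rw [Measure.dirac_apply' _ hm]
    simp [T.shiftBy_mem_X i]
  exact (prob_compl_eq_zero_iff T.isClosed_X.measurableSet).1 this

lemma tendsto_integral_empirical {f : Cantor → ℤ} {M : ℕ} (hf : IsWindow f M) {α : ℝ}
    (hα : T.UniformMean (fun i => (f (shiftBy i T.x) : ℝ)) α) :
    Filter.Tendsto (fun k => ∫ z, (f z : ℝ) ∂(T.empirical k : Measure Cantor)) Filter.atTop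
      (𝓝 α) := by
  rw [Metric.tendsto_atTop']
  intro ε hε
  obtain ⟨K, hK⟩ := hα (ε / 2) (by positivity)
  refine ⟨K, fun k hk => ?_⟩
  have hp : (0 : ℝ) < T.p k := by exact_mod_cast T.p_pos k
  have h := hK k hk.le 0
  simp only [zero_add] at h
  rw [T.integral_empirical k hf, Real.dist_eq, div_sub' hp.ne', abs_div, abs_of_pos hp,
    div_lt_iff₀ hp, mul_comm (T.p k : ℝ)]
  exact h.trans_lt (by gcongr; linarith)

lemma exists_invariant (hV : (1 : ℝ) ∈ V) : ∃ μ : ProbabilityMeasure Cantor,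
    MeasurePreserving shift (μ : Measure Cantor) μ ∧ (μ : Measure Cantor) T.X = 1 := by
  let U : Ultrafilter ℕ := Ultrafilter.of Filter.atTop
  have hU : (U : Filter ℕ) ≤ Filter.atTop := Ultrafilter.of_le _
  obtain ⟨μ, -, hμ⟩ := (isCompact_univ (X := ProbabilityMeasure Cantor)).ultrafilter_le_nhds
    (U.map T.empirical) (by simp)
  have hlim : Filter.Tendsto T.empirical U (𝓝 μ) := hμ
  have hint : ∀ {f : Cantor → ℤ} {M : ℕ} {α : ℝ}, IsWindow f M →
      T.UniformMean (fun i => (f (shiftBy i T.x) : ℝ)) α →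
      ∫ z, (f z : ℝ) ∂(μ : Measure Cantor) = α := by
    intro f M α hf hα
    have h1 := ProbabilityMeasure.tendsto_iff_forall_integral_tendsto.1 hlim
      (BoundedContinuousFunction.mkOfCompact ⟨fun z => (f z : ℝ), hf.continuous_real⟩)
    exact tendsto_nhds_unique h1 ((T.tendsto_integral_empirical hf hα).mono_left hU)
  refine ⟨μ, ⟨measurable_shift, ?_⟩, ?_⟩
  · have : IsProbabilityMeasure ((μ : Measure Cantor).map shift) :=
      Measure.isProbabilityMeasure_map measurable_shift.aemeasurable
    refine measure_ext_of_isWindow fun f M hf => ?_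
    obtain ⟨α, -, hα⟩ := T.exists_uniformMean hV hf
    rw [integral_map measurable_shift.aemeasurable hf.continuous_real.aestronglyMeasurable,
      hint hf hα]
    have hs : ∀ z : Cantor, shift z = shiftBy 1 z := fun z => rfl
    simp only [hs]
    refine hint (hf.comp_shiftBy 1) ?_
    simpa only [shiftBy_shiftBy, add_comm] using hα.shift 1
  · have h := ProbabilityMeasure.limsup_measure_closed_le_of_tendsto hlim T.isClosed_X
    simp only [empirical_X, Filter.limsup_const] at h
    exact le_antisymm prob_le_one h

end Tower

lemma IsInvariantOn.measurePreserving {X : Set Cantor} {μ : ProbabilityMeasure Cantor}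
    (h : IsInvariantOn X μ) : MeasurePreserving shift (μ : Measure Cantor) μ := by
  refine ⟨Tower.measurable_shift, Measure.ext fun B hB => ?_⟩
  rw [Measure.map_apply Tower.measurable_shift hB, h.1 B hB]

lemma integral_comap_subtype {X : Set Cantor} (hX : IsClosed X) {μ : Measure Cantor}
    [IsProbabilityMeasure μ] (h : μ X = 1) (f : Cantor → ℝ) :
    ∫ z : X, f z ∂(μ.comap Subtype.val) = ∫ z, f z ∂μ := by
  rw [integral_subtype_comap hX.measurableSet]
  congr 1
  refine Measure.restrict_eq_self_of_ae_mem ?_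
  exact (prob_compl_eq_zero_iff hX.measurableSet).2 h

theorem stmt6 (a : ℕ → ℝ) :
    ∃ X : Set Cantor, IsRegularToeplitzSubshift X ∧
      ∃ μ : ProbabilityMeasure Cantor, IsInvariantOn X μ ∧
        (∀ ν : ProbabilityMeasure Cantor, IsInvariantOn X ν → ν = μ) ∧
        {r : ℝ | ∃ f : C(X, ℤ),
            r = ∫ z, ((f z : ℤ) : ℝ) ∂(μ.toMeasure.comap (Subtype.val : X → Cantor))} =
          (Submodule.span ℚ ({1} ∪ Set.range a) : Set ℝ) := by
  have hV : (1 : ℝ) ∈ Submodule.span ℚ ({1} ∪ Set.range a) := Submodule.subset_span (by simp)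
  obtain ⟨T⟩ := exists_tower hV (Submodule.countable_span_rat a)
  obtain ⟨μ, hμ, hμX⟩ := T.exists_invariant hV
  refine ⟨T.X, ⟨T.x, T.isRegularToeplitz_x, rfl⟩, μ,
    ⟨fun B hB => hμ.measure_preimage hB.nullMeasurableSet, hμX⟩, fun ν hν => ?_, ?_⟩
  · refine ProbabilityMeasure.toMeasure_injective (measure_ext_of_isWindow fun f M hf => ?_)
    obtain ⟨α, -, hα⟩ := T.exists_uniformMean hV hf
    exact (T.integral_eq hν.measurePreserving hν.2 hf hα).trans
      (T.integral_eq hμ hμX hf hα).symm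
  · ext r
    simp only [Set.mem_ofPred_eq, SetLike.mem_coe]
    constructor
    · rintro ⟨f, rfl⟩
      obtain ⟨g, M, hg, hfg⟩ := exists_isWindow T.isClosed_X.isCompact f
      obtain ⟨α, hαV, hα⟩ := T.exists_uniformMean hV hg
      simp only [hfg]
      rw [integral_comap_subtype T.isClosed_X hμX fun z => (g z : ℝ),
        T.integral_eq hμ hμX hg hα]
      exact hαV
    · intro hr
      obtain ⟨f, M, hf, hα⟩ := T.exists_isWindow_uniformMean hr
      refine ⟨⟨fun z => f z, hf.continuous.comp continuous_subtype_val⟩, ?_⟩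
      change r = ∫ z : T.X, (f z : ℝ) ∂_
      rw [integral_comap_subtype T.isClosed_X hμX fun z => (f z : ℝ),
        T.integral_eq hμ hμX hf hα]
end

section
/- Let X be a Cantor set (a nonempty compact metrizable zero-dimensional space with no isolated points) and let φ be a minimal homeomorphism of X. Let n ≥ 1 and suppose (𝒫_i)_{i∈ℕ} is a sequence of Kakutani–Rohlin partitions of (X,φ), each having at most n towers, such that for every i each member of 𝒫_{i+1} is contained in a member of 𝒫_i, and such that every clopen subset of X is a union of members of 𝒫_i for some i. Then (X,φ) has at most n ergodic invariant Borel probability measures. -/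
open MeasureTheory TopologicalSpace Topology

def InvariantProb {X : Type*} [MeasurableSpace X] (φ : X → X)
    (μ : ProbabilityMeasure X) : Prop :=
  ∀ B : Set X, MeasurableSet B → μ.toMeasure (φ ⁻¹' B) = μ.toMeasure B

def ErgodicProb {X : Type*} [MeasurableSpace X] (φ : X → X)
    (μ : ProbabilityMeasure X) : Prop :=
  InvariantProb φ μ ∧ ∀ B : Set X, MeasurableSet B → φ ⁻¹' B = B →
    μ.toMeasure B = 0 ∨ μ.toMeasure B = 1

/-- A Kakutani–Rohlin partition of `(X, φ)` with `d` towers, with clopen bases `B k` and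
heights `h k`: the sets `φ^j(B k)`, `0 ≤ j < h k`, are pairwise disjoint, cover `X`,
and `⋃ k φ^{h k}(B k) = ⋃ k B k`. -/
structure IsKRPartition {X : Type*} [TopologicalSpace X] (φ : X → X)
    (d : ℕ) (B : Fin d → Set X) (h : Fin d → ℕ) : Prop where
  clopen : ∀ k, IsClopen (B k)
  height_pos : ∀ k, 1 ≤ h k
  disj : ∀ k k' : Fin d, ∀ j j' : ℕ, j < h k → j' < h k' → (k, j) ≠ (k', j') →
    Disjoint (φ^[j] '' B k) (φ^[j'] '' B k')
  cover : (⋃ k, ⋃ j < h k, φ^[j] '' B k) = Set.univ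
  base : (⋃ k, φ^[h k] '' B k) = ⋃ k, B k

theorem Ergodic.mutuallySingular_of_ne {X : Type*} [MeasurableSpace X] {φ : X → X}
    {μ ν : Measure X} [IsProbabilityMeasure μ] [IsProbabilityMeasure ν]
    (hμ : Ergodic φ μ) (hν : Ergodic φ ν) (hne : μ ≠ ν) : μ ⟂ₘ ν := by
  have hinv := hμ.toMeasurePreserving.withDensity_rnDeriv hν.toMeasurePreserving
  have hle : ν.withDensity (μ.rnDeriv ν) ≤ μ := Measure.withDensity_rnDeriv_le μ ν
  obtain ⟨c, hc⟩ := hμ.eq_smul_of_absolutelyContinuous hinv (Measure.absolutelyContinuous_of_le hle)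
  rcases eq_or_ne c 0 with rfl | hc0
  · have hdec := Measure.haveLebesgueDecomposition_add μ ν
    rw [hc, zero_smul, add_zero] at hdec
    rw [hdec]
    exact Measure.mutuallySingular_singularPart μ ν
  · refine absurd (hν.eq_of_absolutelyContinuous hμ.toMeasurePreserving ?_) hne
    refine (Measure.absolutelyContinuous_smul hc0).trans ?_
    rw [← hc]
    exact withDensity_absolutelyContinuous ν _

theorem eq_zero_of_sum_measureReal_eq_zero {X ι : Type*} [MeasurableSpace X] [Fintype ι]
    {μ : ι → Measure X} [∀ m, IsProbabilityMeasure (μ m)]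
    (hsing : Pairwise fun m m' => μ m ⟂ₘ μ m') {c : ι → ℝ}
    (hc : ∀ A, MeasurableSet A → ∑ m, c m * (μ m).real A = 0) : c = 0 := by
  funext m₀
  let ν : {m // m ≠ m₀} → Measure X := fun m => μ m
  have hν : μ m₀ ⟂ₘ Measure.sum ν :=
    Measure.MutuallySingular.sum_right.2 fun m => hsing m.2.symm
  obtain ⟨A, hA, h0, h1⟩ := hν
  have h := hc Aᶜ hA.compl
  rw [Finset.sum_eq_single m₀] at h
  · have h2 : (μ m₀).real Aᶜ = 1 := by
      rw [probReal_compl_eq_one_sub hA, measureReal_def, h0]; simp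
    simpa [h2] using h
  · intro m _ hm
    have := Measure.sum_apply_eq_zero.1 h1 ⟨m, hm⟩
    rw [measureReal_def, show μ m Aᶜ = 0 from this]; simp
  · simp

theorem sum_measureReal_eq_zero_of_isClopen {X ι : Type*} [TopologicalSpace X] [CompactSpace X]
    [MetrizableSpace X] [TotallyDisconnectedSpace X] [MeasurableSpace X] [BorelSpace X] [Fintype ι]
    {μ : ι → Measure X} [∀ m, IsProbabilityMeasure (μ m)] {c : ι → ℝ}
    (hc : ∀ U : Set X, IsClopen U → ∑ m, c m * (μ m).real U = 0)
    {A : Set X} (hA : MeasurableSet A) : ∑ m, c m * (μ m).real A = 0 := by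
  let _ := metrizableSpaceMetric X
  have hgen : ‹MeasurableSpace X› = MeasurableSpace.generateFrom {s : Set X | IsClopen s} := by
    rw [BorelSpace.measurable_eq (α := X)]
    exact isTopologicalBasis_isClopen.borel_eq_generateFrom
  induction A, hA using MeasurableSpace.induction_on_inter hgen
      (fun s hs t ht _ => IsClopen.inter hs ht) with
  | empty => simp
  | basic U hU => exact hc U hU
  | compl A hA ih =>
    have h1 : ∑ m, c m = 0 := by simpa using hc _ isClopen_univ
    simp [probReal_compl_eq_one_sub hA, mul_sub, Finset.sum_sub_distrib, ih, h1]
  | iUnion f hd hm ih =>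
    have hs (m : ι) : HasSum (fun i => c m * (μ m).real (f i)) (c m * (μ m).real (⋃ i, f i)) := by
      refine HasSum.mul_left _ ?_
      have hsum : ∑' i, μ m (f i) ≠ ⊤ := by
        rw [← measure_iUnion hd hm]; exact measure_ne_top _ _
      have := ENNReal.hasSum_toReal hsum
      rwa [← ENNReal.tsum_toReal_eq (fun i => measure_ne_top _ _), ← measure_iUnion hd hm] at this
    have := hasSum_sum fun m (_ : m ∈ Finset.univ) => hs m
    simp only [ih] at this
    exact this.unique hasSum_zero

theorem ErgodicProb.ergodic {X : Type*} [MeasurableSpace X] {φ : X → X} (hφ : Measurable φ)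
    {μ : ProbabilityMeasure X} (h : ErgodicProb φ μ) : Ergodic φ μ.toMeasure where
  measurable := hφ
  map_eq := by
    ext s hs
    rw [Measure.map_apply hφ hs, h.1 s hs]
  aeconst_set s hs hinv := by
    rw [Filter.eventuallyConst_set']
    rcases h.2 s hs hinv with h0 | h1
    · exact .inl (ae_eq_empty.2 h0)
    · exact .inr (by rw [ae_eq_univ, prob_compl_eq_zero_iff hs, h1])

theorem IsHomeomorph.measurableSet_iterate_image {X : Type*} [TopologicalSpace X]
    [MeasurableSpace X] [BorelSpace X] {φ : X → X} (hφ : IsHomeomorph φ) {A : Set X}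
    (hA : MeasurableSet A) (j : ℕ) : MeasurableSet (φ^[j] '' A) := by
  have hj : IsHomeomorph φ^[j] := by
    induction j with
    | zero => exact IsHomeomorph.id
    | succ j ih => exact ih.comp hφ
  exact hj.homeomorph.measurableEmbedding.measurableSet_image.2 hA

theorem InvariantProb.measure_iterate_image {X : Type*} [TopologicalSpace X] [MeasurableSpace X]
    [BorelSpace X] {φ : X → X} (hφ : IsHomeomorph φ) {μ : ProbabilityMeasure X}
    (hμ : InvariantProb φ μ) {A : Set X} (hA : MeasurableSet A) (j : ℕ) :
    μ.toMeasure (φ^[j] '' A) = μ.toMeasure A := by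
  have hpres : MeasurePreserving φ μ.toMeasure μ.toMeasure :=
    ⟨hφ.continuous.measurable, by
      ext s hs; rw [Measure.map_apply hφ.continuous.measurable hs, hμ s hs]⟩
  rw [← (hpres.iterate j).measure_preimage
      (hφ.measurableSet_iterate_image hA j).nullMeasurableSet,
    (hφ.injective.iterate j).preimage_image]

open Classical in
theorem IsKRPartition.measureReal_eq_sum {X : Type*} [TopologicalSpace X] [MeasurableSpace X]
    [BorelSpace X] {φ : X → X} (hφ : IsHomeomorph φ) {d : ℕ} {B : Fin d → Set X} {h : Fin d → ℕ}
    (hP : IsKRPartition φ d B h) {U : Set X}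
    (hU : ∀ k, ∀ j < h k, φ^[j] '' B k ⊆ U ∨ Disjoint (φ^[j] '' B k) U)
    {μ : ProbabilityMeasure X} (hμ : InvariantProb φ μ) :
    μ.toMeasure.real U = ∑ p : (k : Fin d) × Fin (h k) with φ^[p.2] '' B p.1 ⊆ U,
      μ.toMeasure.real (B p.1) := by
  have hunion : U = ⋃ p ∈ ({p : (k : Fin d) × Fin (h k) | φ^[p.2] '' B p.1 ⊆ U} : Finset _),
      φ^[p.2] '' B p.1 := by
    refine Set.Subset.antisymm (fun x hx => ?_) (Set.iUnion₂_subset fun p hp => by simpa using hp)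
    have hx' : x ∈ ⋃ k, ⋃ j < h k, φ^[j] '' B k := hP.cover ▸ Set.mem_univ x
    simp only [Set.mem_iUnion] at hx'
    obtain ⟨k, j, hj, hxj⟩ := hx'
    refine Set.mem_iUnion₂.2 ⟨⟨k, ⟨j, hj⟩⟩, ?_, hxj⟩
    rcases hU k j hj with hsub | hdis
    · simpa using hsub
    · exact (Set.disjoint_left.1 hdis hxj hx).elim
  conv_lhs => rw [hunion]
  rw [measureReal_biUnion_finset]
  · exact Finset.sum_congr rfl fun p _ => by
      simp_rw [measureReal_def, hμ.measure_iterate_image hφ (hP.clopen p.1).2.measurableSet]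
  · rintro ⟨k, j⟩ _ ⟨k', j'⟩ _ hne
    refine hP.disj k k' j j' j.2 j'.2 fun heq => hne ?_
    obtain ⟨rfl, hj⟩ := Prod.mk.inj heq
    rw [Fin.ext hj]
  · exact fun p _ => hφ.measurableSet_iterate_image (hP.clopen p.1).2.measurableSet _

theorem IsKRPartition.sum_measureReal_eq_zero {X ι : Type*} [TopologicalSpace X]
    [MeasurableSpace X] [BorelSpace X] [Fintype ι] {φ : X → X} (hφ : IsHomeomorph φ) {d : ℕ}
    {B : Fin d → Set X} {h : Fin d → ℕ} (hP : IsKRPartition φ d B h) {U : Set X}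
    (hU : ∀ k, ∀ j < h k, φ^[j] '' B k ⊆ U ∨ Disjoint (φ^[j] '' B k) U)
    {μ : ι → ProbabilityMeasure X} (hμ : ∀ m, InvariantProb φ (μ m)) {c : ι → ℝ}
    (hc : ∀ k, ∑ m, c m * (μ m).toMeasure.real (B k) = 0) :
    ∑ m, c m * (μ m).toMeasure.real U = 0 := by
  classical
  simp_rw [hP.measureReal_eq_sum hφ hU (hμ _), Finset.mul_sum]
  rw [Finset.sum_comm]
  exact Finset.sum_eq_zero fun p _ => hc p.1

theorem IsKRPartition.image_subset_or_disjoint_base {X : Type*} [TopologicalSpace X] {φ : X → X}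
    {d : ℕ} {B : Fin d → Set X} {h : Fin d → ℕ} (hP : IsKRPartition φ d B h) {A : Set X}
    (hA : ∃ k, ∃ j < h k, A ⊆ φ^[j] '' B k) (k : Fin d) : A ⊆ B k ∨ Disjoint A (B k) := by
  obtain ⟨k', j', hj', hsub⟩ := hA
  by_cases heq : (k', j') = (k, 0)
  · obtain ⟨rfl, rfl⟩ := Prod.mk.inj heq
    exact .inl (by simpa using hsub)
  · have := hP.disj k' k j' 0 hj' (hP.height_pos k) heq
    exact .inr (by simpa using this.mono_left hsub)

theorem Submodule.exists_ne_zero_forall_mem_of_antitone {R M : Type*} [Ring R] [AddCommGroup M]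
    [Module R M] [IsArtinian R M] {K : ℕ → Submodule R M} (hK : Antitone K)
    (hne : ∀ i, K i ≠ ⊥) : ∃ c ≠ 0, ∀ i, c ∈ K i := by
  obtain ⟨N, hN⟩ := IsArtinian.monotone_stabilizes (R := R) (M := M)
    ⟨fun i => OrderDual.toDual (K i), fun _ _ hij => hK hij⟩
  obtain ⟨c, hc, hc0⟩ := (K N).exists_mem_ne_zero_of_ne_bot (hne N)
  refine ⟨c, hc0, fun i => ?_⟩
  rcases le_total N i with hi | hi
  · have : K N = K i := hN i hi
    exact this ▸ hc
  · exact hK hi hc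

theorem stmt7 {X : Type*} [TopologicalSpace X] [CompactSpace X] [MetrizableSpace X]
    [TotallyDisconnectedSpace X] [Nonempty X]
    (hperf : ∀ x : X, Filter.NeBot (nhdsWithin x {x}ᶜ))
    [MeasurableSpace X] [BorelSpace X]
    (φ : X → X) (hφ : IsHomeomorph φ)
    (hmin : ∀ x : X, Dense (zOrbit φ x))
    (n : ℕ) (hn : 1 ≤ n)
    (d : ℕ → ℕ) (hd : ∀ i, d i ≤ n)
    (B : ∀ i, Fin (d i) → Set X) (h : ∀ i, Fin (d i) → ℕ)
    (hKR : ∀ i, IsKRPartition φ (d i) (B i) (h i))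
    (href : ∀ i, ∀ k : Fin (d (i + 1)), ∀ j < h (i + 1) k,
      ∃ k' : Fin (d i), ∃ j' < h i k', φ^[j] '' B (i + 1) k ⊆ φ^[j'] '' B i k')
    (hgen : ∀ U : Set X, IsClopen U → ∃ i, ∀ k : Fin (d i), ∀ j < h i k,
      φ^[j] '' B i k ⊆ U ∨ Disjoint (φ^[j] '' B i k) U) :
    ∃ s : Finset (ProbabilityMeasure X), s.card ≤ n ∧
      ∀ μ : ProbabilityMeasure X, ErgodicProb φ μ → μ ∈ s := by
  have hcard (t : Finset (ProbabilityMeasure X)) (ht : ∀ μ ∈ t, ErgodicProb φ μ) :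
      t.card ≤ n := by
    by_contra! hlt
    let L (i : ℕ) : (t → ℝ) →ₗ[ℝ] (Fin (d i) → ℝ) :=
      Matrix.mulVecLin (Matrix.of fun k m => m.1.toMeasure.real (B i k))
    have hL (i : ℕ) (c : t → ℝ) :
        c ∈ LinearMap.ker (L i) ↔ ∀ k, ∑ m : t, c m * m.1.toMeasure.real (B i k) = 0 := by
      simp [L, LinearMap.mem_ker, funext_iff, Matrix.mulVec, dotProduct, mul_comm]
    have hinv (m : t) : InvariantProb φ m.1 := (ht m.1 m.2).1
    have hanti : Antitone fun i => LinearMap.ker (L i) := by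
      refine antitone_nat_of_succ_le fun i c hc => (hL i c).2 fun k => ?_
      exact (hKR (i + 1)).sum_measureReal_eq_zero hφ (fun k' j hj =>
        (hKR i).image_subset_or_disjoint_base (href i k' j hj) k) hinv ((hL (i + 1) c).1 hc)
    obtain ⟨c, hc0, hc⟩ := Submodule.exists_ne_zero_forall_mem_of_antitone hanti fun i =>
      LinearMap.ker_ne_bot_of_finrank_lt (by simpa using (hd i).trans_lt hlt)
    refine hc0 (eq_zero_of_sum_measureReal_eq_zero (μ := fun m : t => m.1.toMeasure)
      (fun m m' hne => ?_) fun A hA => sum_measureReal_eq_zero_of_isClopen (fun U hU => ?_) hA)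
    · exact ((ht m.1 m.2).ergodic hφ.continuous.measurable).mutuallySingular_of_ne
        ((ht m'.1 m'.2).ergodic hφ.continuous.measurable)
        fun heq => hne (Subtype.ext (Subtype.ext heq))
    · obtain ⟨i, hi⟩ := hgen U hU
      exact (hKR i).sum_measureReal_eq_zero hφ hi hinv ((hL i c).1 (hc i))
  have hfin : {μ : ProbabilityMeasure X | ErgodicProb φ μ}.Finite := by
    by_contra hinf
    obtain ⟨t, hts, htc⟩ := Set.Infinite.exists_subset_card_eq hinf (n + 1)
    have := hcard t fun μ hμ => hts hμ
    omega
  exact ⟨hfin.toFinset, hcard _ fun μ hμ => by simpa using hμ, fun μ hμ => by simpa using hμ⟩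
end
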